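/- arXiv:2302.14219 — 8 statements merged into one kernel-verified Lean document; each statement's English description precedes it below -/
import Mathlib

section
/- For every real γ > 0 there exists a constant κ_γ > 0 depending only on γ such that the following holds for every integer n ≥ 2 satisfying γ < n/ln n and every ε ∈ (0,1): if t = ⌈κ_γ · n^{2γ} · √(ln n) · (n ln n + ln(1/ε))⌉ and z₁, …, z_t are drawn independently from the uniform probability measure on Sⁿ (the normalized rotation-invariant surface measure), then with probability at least 1 − ε the set {z₁, …, z_t} is a √(γ ln n / (2n))-hitting set of Sⁿ. -/
open MeasureTheory
open scoped RealInnerProductSpace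

/-- A set `H` of unit vectors in `ℝⁿ` is a `τ`-hitting set of the unit sphere `Sⁿ` if every
unit vector `x` satisfies `⟨x, v⟩ ≥ τ` for some `v ∈ H`. -/
def IsHittingSet {n : ℕ} (H : Set (EuclideanSpace ℝ (Fin n))) (τ : ℝ) : Prop :=
  (∀ v ∈ H, ‖v‖ = 1) ∧
    ∀ x : EuclideanSpace ℝ (Fin n), ‖x‖ = 1 → ∃ v ∈ H, τ ≤ ⟪x, v⟫

/-- The map induced on the unit sphere of `ℝⁿ` by a linear isometry (rotation) of `ℝⁿ`. -/
noncomputable def sphereMap {n : ℕ}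
    (f : EuclideanSpace ℝ (Fin n) ≃ₗᵢ[ℝ] EuclideanSpace ℝ (Fin n))
    (x : Metric.sphere (0 : EuclideanSpace ℝ (Fin n)) 1) :
    Metric.sphere (0 : EuclideanSpace ℝ (Fin n)) 1 :=
  ⟨f x, by
    rw [mem_sphere_zero_iff_norm, f.norm_map]
    exact mem_sphere_zero_iff_norm.mp x.2⟩

open ProbabilityTheory
open scoped ENNReal

lemma gaussianReal_Ici_ge {a : ℝ} (ha : 0 ≤ a) :
    ENNReal.ofReal ((√(2 * Real.pi))⁻¹ * Real.exp (-(a + 1) ^ 2 / 2)) ≤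
      gaussianReal 0 1 (Set.Ici a) := by
  set c := ENNReal.ofReal ((√(2 * Real.pi))⁻¹ * Real.exp (-(a + 1) ^ 2 / 2))
  calc c = ∫⁻ _ in Set.Icc a (a + 1), c := by simp
    _ ≤ ∫⁻ x in Set.Icc a (a + 1), gaussianPDF 0 1 x := by
        refine setLIntegral_mono' measurableSet_Icc fun x hx => ?_
        refine ENNReal.ofReal_le_ofReal ?_
        simp only [gaussianPDFReal, NNReal.coe_one, mul_one, sub_zero]
        gcongr
        · linarith [hx.1]
        · exact hx.2
    _ = gaussianReal 0 1 (Set.Icc a (a + 1)) := (gaussianReal_apply 0 one_ne_zero _).symm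
    _ ≤ _ := measure_mono Set.Icc_subset_Ici_self

lemma lintegral_sq_gaussianReal :
    ∫⁻ x, ENNReal.ofReal (x ^ 2) ∂gaussianReal 0 1 = 1 := by
  have hi : Integrable (fun x : ℝ => x ^ 2) (gaussianReal 0 1) :=
    (memLp_id_gaussianReal' 2 (by simp)).integrable_sq
  rw [← ofReal_integral_eq_lintegral_ofReal hi (.of_forall fun x => sq_nonneg x)]
  have h := variance_fun_id_gaussianReal (μ := 0) (v := 1)
  rw [variance_of_integral_eq_zero (by fun_prop) (by simp)] at h
  rw [h]; simp

lemma pi_gaussianReal_sum_sq_lt_ge (m : ℕ) :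
    1 / 2 ≤ Measure.pi (fun _ : Fin m => gaussianReal 0 1)
      {y | ∑ i, y i ^ 2 < 2 * ((m : ℝ) + 1)} := by
  set P := Measure.pi (fun _ : Fin m => gaussianReal 0 1)
  have hmean : ∫⁻ y, ENNReal.ofReal (∑ i, y i ^ 2) ∂P = m := by
    simp_rw [ENNReal.ofReal_sum_of_nonneg fun i _ => sq_nonneg _]
    rw [lintegral_finsetSum _ fun i _ => by fun_prop]
    have h (i : Fin m) : ∫⁻ y, ENNReal.ofReal (y i ^ 2) ∂P = 1 := by
      rw [← lintegral_sq_gaussianReal]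
      exact (measurePreserving_eval (fun _ : Fin m => gaussianReal 0 1) i).lintegral_comp
        (f := fun x => ENNReal.ofReal (x ^ 2)) (by fun_prop)
    simp [h]
  have hmarkov := mul_meas_ge_le_lintegral (μ := P)
    (f := fun y => ENNReal.ofReal (∑ i, y i ^ 2)) (by fun_prop) (2 * ((m : ℝ≥0∞) + 1))
  rw [hmean] at hmarkov
  have hset : {y : Fin m → ℝ | ∑ i, y i ^ 2 < 2 * ((m : ℝ) + 1)}ᶜ =
      {y | 2 * ((m : ℝ≥0∞) + 1) ≤ ENNReal.ofReal (∑ i, y i ^ 2)} := by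
    ext y
    have : 2 * ((m : ℝ≥0∞) + 1) = ENNReal.ofReal (2 * ((m : ℝ) + 1)) := by
      rw [ENNReal.ofReal_mul (by norm_num), ENNReal.ofReal_add (by positivity) (by norm_num)]
      simp
    simp only [Set.mem_compl_iff, Set.mem_ofPred_eq, not_lt, this]
    rw [ENNReal.ofReal_le_ofReal_iff (Finset.sum_nonneg fun i _ => sq_nonneg _)]
  rw [← hset] at hmarkov
  have hmeas : MeasurableSet {y : Fin m → ℝ | ∑ i, y i ^ 2 < 2 * ((m : ℝ) + 1)} :=
    measurableSet_lt (by fun_prop) (by fun_prop)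
  rw [prob_compl_eq_one_sub hmeas] at hmarkov
  have hle : P {y | ∑ i, y i ^ 2 < 2 * ((m : ℝ) + 1)} ≤ 1 := prob_le_one
  generalize P {y | ∑ i, y i ^ 2 < 2 * ((m : ℝ) + 1)} = q at *
  lift q to NNReal using (hle.trans_lt ENNReal.one_lt_top).ne
  have h1 : (2 * ((m : ℝ) + 1)) * (1 - q) ≤ m := by
    have : (2 * ((m : NNReal) + 1)) * (1 - q) ≤ m := by exact_mod_cast hmarkov
    have h2 : ((1 - q : NNReal) : ℝ) = 1 - q := NNReal.coe_sub (by exact_mod_cast hle)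
    have h3 : (((2 * ((m : NNReal) + 1)) * (1 - q) : NNReal) : ℝ) ≤ m := by exact_mod_cast this
    push_cast [h2] at h3
    exact h3
  have h4 : (1 / 2 : ℝ) ≤ q := by
    by_contra! h
    nlinarith [(Nat.cast_nonneg m : (0 : ℝ) ≤ m)]
  have h5 : (1 / 2 : NNReal) ≤ q := by exact_mod_cast h4
  calc (1 / 2 : ℝ≥0∞) = ((1 / 2 : NNReal) : ℝ≥0∞) := by simp
    _ ≤ q := by exact_mod_cast h5

lemma measurableSet_pos_and_le {α : Type*} [MeasurableSpace α] {f g : α → ℝ}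
    (hf : Measurable f) (hg : Measurable g) : MeasurableSet {y | 0 < f y ∧ g y ≤ f y} := by
  rw [show {y | 0 < f y ∧ g y ≤ f y} = {y | 0 < f y} ∩ {y | g y ≤ f y} from rfl]
  exact (measurableSet_lt measurable_const hf).inter (measurableSet_le hg hf)

lemma stdGaussian_cone_zero_ge {m : ℕ} {s a : ℝ} (ha : 0 < a) (hs : 0 ≤ s) (hs1 : s ≤ 1)
    (has : s ^ 2 * (a ^ 2 + 2 * ((m : ℝ) + 1)) ≤ a ^ 2) :
    gaussianReal 0 1 (Set.Ici a) * (1 / 2) ≤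
      stdGaussian (EuclideanSpace ℝ (Fin (m + 1))) {y | 0 < y 0 ∧ s * ‖y‖ ≤ y 0} := by
  have hm : MeasurableSet {y : EuclideanSpace ℝ (Fin (m + 1)) | 0 < y 0 ∧ s * ‖y‖ ≤ y 0} :=
    measurableSet_pos_and_le (by fun_prop) (by fun_prop)
  rw [← map_pi_eq_stdGaussian, Measure.map_apply (by fun_prop) hm]
  rw [← (measurePreserving_piFinSuccAbove
    (fun _ : Fin (m + 1) => gaussianReal 0 1) 0).symm.measure_preimage_equiv]
  refine (mul_le_mul_right (pi_gaussianReal_sum_sq_lt_ge m) _).trans ?_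
  rw [← Measure.prod_prod]
  refine measure_mono ?_
  rintro ⟨u, w⟩ ⟨hu, hw⟩
  simp only [Set.mem_Ici, Set.mem_ofPred_eq] at hu hw
  simp only [Set.mem_preimage, Set.mem_ofPred_eq]
  have h0 : 0 < u := ha.trans_le hu
  refine ⟨by simpa using h0, (sq_le_sq₀ (by positivity) (by simpa using h0.le)).1 ?_⟩
  rw [mul_pow, EuclideanSpace.real_norm_sq_eq, Fin.sum_univ_succ]
  simp
  have h1 : a ^ 2 ≤ u ^ 2 := by gcongr
  have h2 : s ^ 2 ≤ 1 := pow_le_one₀ hs hs1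
  nlinarith [mul_nonneg (sub_nonneg.2 h1) (sub_nonneg.2 h2),
    mul_nonneg (sq_nonneg s) (sub_nonneg.2 hw.le)]

lemma exists_linearIsometryEquiv_apply_eq {E : Type*} [NormedAddCommGroup E]
    [InnerProductSpace ℝ E] {v w : E} (h : ‖v‖ = ‖w‖) : ∃ f : E ≃ₗᵢ[ℝ] E, f v = w :=
  ⟨(ℝ ∙ (v - w))ᗮ.reflection, Submodule.reflection_sub h⟩

lemma stdGaussian_cone_ge {m : ℕ} {s a : ℝ} (ha : 0 < a) (hs : 0 ≤ s) (hs1 : s ≤ 1)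
    (has : s ^ 2 * (a ^ 2 + 2 * ((m : ℝ) + 1)) ≤ a ^ 2)
    {x : EuclideanSpace ℝ (Fin (m + 1))} (hx : ‖x‖ = 1) :
    gaussianReal 0 1 (Set.Ici a) * (1 / 2) ≤
      stdGaussian (EuclideanSpace ℝ (Fin (m + 1))) {y | 0 < ⟪x, y⟫ ∧ s * ‖y‖ ≤ ⟪x, y⟫} := by
  obtain ⟨f, hf⟩ := exists_linearIsometryEquiv_apply_eq
    (v := EuclideanSpace.single (0 : Fin (m + 1)) (1 : ℝ)) (w := x) (by simp [hx])
  rw [← stdGaussian_map f, Measure.map_apply (by fun_prop)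
    (measurableSet_pos_and_le (by fun_prop) (by fun_prop))]
  convert stdGaussian_cone_zero_ge ha hs hs1 has using 3 with y
  simp [← hf, EuclideanSpace.inner_single_left]

lemma measurable_sphereMap {n : ℕ}
    (f : EuclideanSpace ℝ (Fin n) ≃ₗᵢ[ℝ] EuclideanSpace ℝ (Fin n)) : Measurable (sphereMap f) :=
  (f.continuous.measurable.comp measurable_subtype_coe).subtype_mk

section Cap

variable {n : ℕ} {μ : Measure (Metric.sphere (0 : EuclideanSpace ℝ (Fin n)) 1)}

lemma measurableSet_cap (x : EuclideanSpace ℝ (Fin n)) (s : ℝ) :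
    MeasurableSet {z : Metric.sphere (0 : EuclideanSpace ℝ (Fin n)) 1 | s ≤ ⟪x, (z : _)⟫} :=
  measurableSet_le (by fun_prop) (by fun_prop)

lemma measure_cap_eq
    (hμ : ∀ f : EuclideanSpace ℝ (Fin n) ≃ₗᵢ[ℝ] EuclideanSpace ℝ (Fin n),
      μ.map (sphereMap f) = μ)
    {x y : EuclideanSpace ℝ (Fin n)} (h : ‖x‖ = ‖y‖) (s : ℝ) :
    μ {z | s ≤ ⟪x, (z : _)⟫} = μ {z | s ≤ ⟪y, (z : _)⟫} := by
  obtain ⟨f, hf⟩ := exists_linearIsometryEquiv_apply_eq h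
  conv_rhs => rw [← hμ f, Measure.map_apply (measurable_sphereMap f) (measurableSet_cap y s)]
  congr 1
  ext z
  simp [sphereMap, ← hf]

lemma measure_cap_ge [IsProbabilityMeasure μ]
    (hμ : ∀ f : EuclideanSpace ℝ (Fin n) ≃ₗᵢ[ℝ] EuclideanSpace ℝ (Fin n),
      μ.map (sphereMap f) = μ) {s : ℝ} {b : ℝ≥0∞}
    (hb : ∀ x : EuclideanSpace ℝ (Fin n), ‖x‖ = 1 →
      b ≤ stdGaussian (EuclideanSpace ℝ (Fin n)) {y | 0 < ⟪x, y⟫ ∧ s * ‖y‖ ≤ ⟪x, y⟫})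
    {x : EuclideanSpace ℝ (Fin n)} (hx : ‖x‖ = 1) :
    b ≤ μ {z | s ≤ ⟪x, (z : _)⟫} := by
  set G := stdGaussian (EuclideanSpace ℝ (Fin n))
  set A : Set (Metric.sphere (0 : EuclideanSpace ℝ (Fin n)) 1 × EuclideanSpace ℝ (Fin n)) :=
    {p | 0 < ⟪(p.1 : EuclideanSpace ℝ (Fin n)), p.2⟫ ∧
      s * ‖p.2‖ ≤ ⟪(p.1 : EuclideanSpace ℝ (Fin n)), p.2⟫}
  have hA : MeasurableSet A := measurableSet_pos_and_le (by fun_prop) (by fun_prop)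
  calc b = ∫⁻ _, b ∂μ := by simp
    _ ≤ ∫⁻ z, G (Prod.mk z ⁻¹' A) ∂μ := lintegral_mono fun z => hb z (by simp)
    _ = ∫⁻ y, μ ((fun z => (z, y)) ⁻¹' A) ∂G := by
        rw [← Measure.prod_apply hA, Measure.prod_apply_symm hA]
    _ ≤ ∫⁻ _, μ {z | s ≤ ⟪x, (z : _)⟫} ∂G := by
        refine lintegral_mono fun y => ?_
        rcases eq_or_ne y 0 with rfl | hy
        · simp [A]
        · have hy' : 0 < ‖y‖ := norm_pos_iff.2 hy
          rw [measure_cap_eq hμ (y := ‖y‖⁻¹ • y) (by simp [norm_smul, hx, hy'.ne']) s]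
          refine measure_mono fun z hz => ?_
          have hz2 : s * ‖y‖ ≤ ⟪(z : EuclideanSpace ℝ (Fin n)), y⟫ := hz.2
          simp only [Set.mem_ofPred_eq, real_inner_smul_left]
          rw [real_inner_comm, inv_mul_eq_div]
          exact (le_div_iff₀ hy').2 hz2
    _ = _ := by simp

lemma exists_finset_sphere_net (n M : ℕ) (hM : 0 < M) :
    ∃ N : Finset (EuclideanSpace ℝ (Fin n)), N.card ≤ (2 * M + 1) ^ n ∧ (∀ y ∈ N, ‖y‖ = 1) ∧
      ∀ x : EuclideanSpace ℝ (Fin n), ‖x‖ = 1 → ∃ y ∈ N, ‖x - y‖ ≤ √n / M := by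
  classical
  have hM' : (0 : ℝ) < M := by exact_mod_cast hM
  have habs (x : Metric.sphere (0 : EuclideanSpace ℝ (Fin n)) 1) (i : Fin n) :
      |(x : EuclideanSpace ℝ (Fin n)) i| ≤ 1 := by
    simpa using PiLp.norm_apply_le (x : EuclideanSpace ℝ (Fin n)) i
  have hlt (x : Metric.sphere (0 : EuclideanSpace ℝ (Fin n)) 1) (i : Fin n) :
      ⌊((x : EuclideanSpace ℝ (Fin n)) i + 1) * M⌋₊ < 2 * M + 1 := by
    rw [Nat.lt_succ_iff]
    refine Nat.floor_le_of_le ?_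
    push_cast
    nlinarith [(abs_le.1 (habs x i)).2]
  let F (x : Metric.sphere (0 : EuclideanSpace ℝ (Fin n)) 1) : Fin n → Fin (2 * M + 1) :=
    fun i => ⟨_, hlt x i⟩
  have hF : ∀ x y, F x = F y → ‖(x : EuclideanSpace ℝ (Fin n)) - y‖ ≤ √n / M := by
    intro x y hxy
    have hi (i : Fin n) : ((x - y : EuclideanSpace ℝ (Fin n)) i) ^ 2 ≤ (1 / M) ^ 2 := by
      have h := congrArg Fin.val (congrFun hxy i)
      simp only [F] at h
      have hx0 : 0 ≤ ((x : EuclideanSpace ℝ (Fin n)) i + 1) * M :=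
        mul_nonneg (by linarith [(abs_le.1 (habs x i)).1]) hM'.le
      have hy0 : 0 ≤ ((y : EuclideanSpace ℝ (Fin n)) i + 1) * M :=
        mul_nonneg (by linarith [(abs_le.1 (habs y i)).1]) hM'.le
      have h1 := Nat.floor_le hx0
      have h2 := Nat.lt_floor_add_one (((x : EuclideanSpace ℝ (Fin n)) i + 1) * M)
      have h3 := Nat.floor_le hy0
      have h4 := Nat.lt_floor_add_one (((y : EuclideanSpace ℝ (Fin n)) i + 1) * M)
      rw [h] at h1 h2
      refine sq_le_sq' ?_ ?_
      · rw [PiLp.sub_apply, ← neg_div, div_le_iff₀ hM']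
        linarith
      · rw [PiLp.sub_apply, le_div_iff₀ hM']
        linarith
    rw [EuclideanSpace.norm_eq]
    refine Real.sqrt_le_iff.2 ⟨by positivity, ?_⟩
    calc ∑ i, ‖(x - y : EuclideanSpace ℝ (Fin n)) i‖ ^ 2
        ≤ ∑ _i : Fin n, ((1 : ℝ) / M) ^ 2 := Finset.sum_le_sum fun i _ => by simpa using hi i
      _ = (√n / M) ^ 2 := by
        rw [div_pow (√(n : ℝ)), Real.sq_sqrt (by positivity)]
        simp
        ring
  let R : Set.range F → EuclideanSpace ℝ (Fin n) := fun c => (c.2.choose : _)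
  refine ⟨Finset.univ.image R, ?_, ?_, ?_⟩
  · refine Finset.card_image_le.trans ?_
    rw [Finset.card_univ]
    refine (Fintype.card_subtype_le _).trans ?_
    simp
  · simp only [Finset.mem_image, Finset.mem_univ, true_and]
    rintro y ⟨c, rfl⟩
    exact mem_sphere_zero_iff_norm.1 c.2.choose.2
  · intro x hx
    let x' : Metric.sphere (0 : EuclideanSpace ℝ (Fin n)) 1 := ⟨x, by simpa using hx⟩
    let c : Set.range F := ⟨F x', x', rfl⟩
    exact ⟨R c, Finset.mem_image_of_mem _ (Finset.mem_univ _), hF x' _ c.2.choose_spec.symm⟩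

/-- The union bound over a net. -/
lemma pi_isHittingSet_ge [IsProbabilityMeasure μ] (N : Finset (EuclideanSpace ℝ (Fin n)))
    {δ s τ q : ℝ} (hs : τ + δ ≤ s) (hq : 0 ≤ q)
    (hN : ∀ x : EuclideanSpace ℝ (Fin n), ‖x‖ = 1 → ∃ y ∈ N, ‖x - y‖ ≤ δ)
    (hcap : ∀ y ∈ N, ENNReal.ofReal q ≤ μ {z | s ≤ ⟪y, (z : _)⟫}) (t : ℕ) :
    ENNReal.ofReal (1 - N.card * Real.exp (-q * t)) ≤
      Measure.pi (fun _ : Fin t => μ)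
        {z | IsHittingSet (Set.range fun i => ((z i : EuclideanSpace ℝ (Fin n)))) τ} := by
  set P := Measure.pi (fun _ : Fin t => μ)
  let B (y : EuclideanSpace ℝ (Fin n)) :
      Set (Fin t → Metric.sphere (0 : EuclideanSpace ℝ (Fin n)) 1) :=
    Set.pi Set.univ fun _ => {z | s ≤ ⟪y, (z : _)⟫}ᶜ
  have hB : ∀ y ∈ N, P (B y) ≤ ENNReal.ofReal (Real.exp (-q * t)) := by
    intro y hy
    rw [Measure.pi_pi, Finset.prod_const, Finset.card_univ, Fintype.card_fin,
      prob_compl_eq_one_sub (measurableSet_cap y s)]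
    have h1 : 1 - μ {z | s ≤ ⟪y, (z : _)⟫} ≤ ENNReal.ofReal (Real.exp (-q)) := by
      refine (tsub_le_tsub_left (hcap y hy) 1).trans ?_
      rw [← ENNReal.ofReal_one, ← ENNReal.ofReal_sub _ hq]
      exact ENNReal.ofReal_le_ofReal (by linarith [Real.add_one_le_exp (-q)])
    calc _ ≤ ENNReal.ofReal (Real.exp (-q)) ^ t := by gcongr
      _ = _ := by
        rw [← ENNReal.ofReal_pow (Real.exp_nonneg _), ← Real.exp_nat_mul]
        ring_nf
  set H := {z : Fin t → Metric.sphere (0 : EuclideanSpace ℝ (Fin n)) 1 |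
    IsHittingSet (Set.range fun i => ((z i : EuclideanSpace ℝ (Fin n)))) τ}
  have hcover : Set.univ ⊆ H ∪ ⋃ y ∈ N, B y := by
    intro z _
    by_cases hz : ∃ y ∈ N, z ∈ B y
    · exact Or.inr (by simpa using hz)
    refine Or.inl ⟨?_, fun x hx => ?_⟩
    · rintro _ ⟨i, rfl⟩
      exact mem_sphere_zero_iff_norm.1 (z i).2
    obtain ⟨y, hy, hxy⟩ := hN x hx
    have hzy : z ∉ B y := fun h => hz ⟨y, hy, h⟩
    simp only [B, Set.mem_univ_pi, not_forall, Set.mem_compl_iff, not_not] at hzy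
    obtain ⟨i, hi⟩ := hzy
    refine ⟨_, ⟨i, rfl⟩, ?_⟩
    have hi' : s ≤ ⟪y, (z i : EuclideanSpace ℝ (Fin n))⟫ := hi
    have h1 : |⟪x - y, (z i : EuclideanSpace ℝ (Fin n))⟫| ≤ ‖x - y‖ := by
      simpa using abs_real_inner_le_norm (x - y) (z i : EuclideanSpace ℝ (Fin n))
    rw [inner_sub_left] at h1
    linarith [(abs_le.1 h1).1]
  have htotal : 1 ≤ P H + ENNReal.ofReal (N.card * Real.exp (-q * t)) := by
    calc (1 : ℝ≥0∞) = P Set.univ := measure_univ.symm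
      _ ≤ P H + P (⋃ y ∈ N, B y) := (measure_mono hcover).trans (measure_union_le _ _)
      _ ≤ P H + ∑ y ∈ N, P (B y) := by gcongr; exact measure_biUnion_finset_le _ _
      _ ≤ P H + ∑ _y ∈ N, ENNReal.ofReal (Real.exp (-q * t)) := by
        gcongr with y hy; exact hB y hy
      _ = _ := by
        rw [Finset.sum_const, nsmul_eq_mul, ENNReal.ofReal_mul (by positivity),
          ENNReal.ofReal_natCast]
  rw [ENNReal.ofReal_sub _ (by positivity), ENNReal.ofReal_one]
  exact tsub_le_iff_right.2 htotal

end Cap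

lemma measure_cap_ge_rpow {n : ℕ} (hn : 2 ≤ n) {γ : ℝ} (hγ : 0 < γ)
    (hγn : γ < (n : ℝ) / Real.log n)
    {μ : Measure (Metric.sphere (0 : EuclideanSpace ℝ (Fin n)) 1)} [IsProbabilityMeasure μ]
    (hμ : ∀ f : EuclideanSpace ℝ (Fin n) ≃ₗᵢ[ℝ] EuclideanSpace ℝ (Fin n),
      μ.map (sphereMap f) = μ)
    {x : EuclideanSpace ℝ (Fin n)} (hx : ‖x‖ = 1) :
    ENNReal.ofReal (Real.exp (-4) / (2 * √(2 * Real.pi)) * (n : ℝ) ^ (-(2 * γ))) ≤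
      μ {z | √(γ * Real.log n / (2 * n)) + 1 / (16 * n) ≤ ⟪x, (z : _)⟫} := by
  have hn2 : (2 : ℝ) ≤ n := by exact_mod_cast hn
  have hn0 : (0 : ℝ) < n := by linarith
  have hlog : 0 < Real.log n := Real.log_pos (by linarith)
  have hγlog : γ * Real.log n < n := (lt_div_iff₀ hlog).1 hγn
  set L := γ * Real.log n with hL
  have hL0 : 0 < L := mul_pos hγ hlog
  set τ := √(L / (2 * n)) with hτ
  have hτ0 : 0 ≤ τ := Real.sqrt_nonneg _
  have hτsq : τ ^ 2 = L / (2 * n) := Real.sq_sqrt (by positivity)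
  have hτn : 2 * n * τ ^ 2 = L := by rw [hτsq]; field_simp
  have hτhalf : τ ^ 2 ≤ 1 / 2 := by
    rw [hτsq, div_le_iff₀ (by positivity)]; linarith
  have hτ1 : τ ≤ 3 / 4 := by nlinarith
  set δ : ℝ := 1 / (16 * n) with hδ
  have hδ0 : 0 < δ := by positivity
  have hδn : n * δ = 1 / 16 := by rw [hδ]; field_simp
  have hδ1 : δ ≤ 1 / 32 := by nlinarith
  set s := τ + δ with hs
  have hs0 : 0 < s := by positivity
  have hssq : s ^ 2 ≤ 3 / 5 := by nlinarith
  have hns : 2 * n * s ^ 2 ≤ L + 1 := by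
    have : 2 * n * s ^ 2 = L + 4 * (n * δ) * τ + 2 * (n * δ) * δ := by rw [← hτn, hs]; ring
    rw [this, hδn]
    linarith
  have hs1 : s ≤ 1 := by nlinarith
  set a := √(2 * n * s ^ 2 / (1 - s ^ 2)) with ha
  have hden : 0 < 1 - s ^ 2 := by linarith
  have hasq : a ^ 2 = 2 * n * s ^ 2 / (1 - s ^ 2) := Real.sq_sqrt (by positivity)
  have ha0 : 0 < a := Real.sqrt_pos.2 (by positivity)
  have haL : a ^ 2 ≤ 5 / 2 * (L + 1) := by
    rw [hasq, div_le_iff₀ hden]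
    nlinarith
  obtain ⟨m, rfl⟩ : ∃ m, n = m + 1 := ⟨n - 1, by omega⟩
  have hcone : s ^ 2 * (a ^ 2 + 2 * ((m : ℝ) + 1)) ≤ a ^ 2 := by
    have : a ^ 2 * (1 - s ^ 2) = 2 * ((m : ℝ) + 1) * s ^ 2 := by
      rw [hasq]; push_cast; field_simp
    linarith
  refine le_trans ?_ (measure_cap_ge hμ (fun y hy => stdGaussian_cone_ge ha0 hs0.le hs1 hcone hy) hx)
  refine le_trans ?_ (mul_le_mul_left (gaussianReal_Ici_ge ha0.le) _)
  have hhalf : (1 / 2 : ℝ≥0∞) = ENNReal.ofReal (1 / 2) := by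
    rw [ENNReal.ofReal_div_of_pos (by norm_num)]; simp
  rw [hhalf, ← ENNReal.ofReal_mul (by positivity)]
  refine ENNReal.ofReal_le_ofReal ?_
  have hexp : Real.exp (-4) * ((m + 1 : ℕ) : ℝ) ^ (-(2 * γ)) ≤ Real.exp (-(a + 1) ^ 2 / 2) := by
    rw [Real.rpow_def_of_pos hn0, ← Real.exp_add]
    refine Real.exp_le_exp.2 ?_
    nlinarith [sq_nonneg (a - 2)]
  calc _ = (√(2 * Real.pi))⁻¹ * (Real.exp (-4) * ((m + 1 : ℕ) : ℝ) ^ (-(2 * γ))) * (1 / 2) := by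
        field_simp
    _ ≤ _ := by gcongr

/-- For every `γ > 0` there exists `κ_γ > 0` such that for every integer
`n ≥ 2` with `γ < n/ln n` and every `ε ∈ (0,1)`: if
`t = ⌈κ_γ · n^{2γ} · √(ln n) · (n ln n + ln(1/ε))⌉` and `z₁, …, z_t` are drawn i.i.d. from
the uniform (rotation-invariant) probability measure on `Sⁿ`, then with probability at
least `1 − ε` the set `{z₁, …, z_t}` is a `√(γ ln n/(2n))`-hitting set of `Sⁿ`. -/
theorem stmt0 (γ : ℝ) (hγ : 0 < γ) :
    ∃ κ : ℝ, 0 < κ ∧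
      ∀ n : ℕ, 2 ≤ n → γ < (n : ℝ) / Real.log n →
        ∀ ε : ℝ, 0 < ε → ε < 1 →
          ∀ (μ : Measure (Metric.sphere (0 : EuclideanSpace ℝ (Fin n)) 1))
            [IsProbabilityMeasure μ],
            (∀ f : EuclideanSpace ℝ (Fin n) ≃ₗᵢ[ℝ] EuclideanSpace ℝ (Fin n),
                μ.map (sphereMap f) = μ) →
            ENNReal.ofReal (1 - ε) ≤
              Measure.pi
                (fun _ : Fin (⌈κ * (n : ℝ) ^ (2 * γ) * Real.sqrt (Real.log n) *
                    ((n : ℝ) * Real.log n + Real.log (1 / ε))⌉₊) => μ)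
                {z | IsHittingSet
                    (Set.range fun i => ((z i : EuclideanSpace ℝ (Fin n))))
                    (Real.sqrt (γ * Real.log n / (2 * n)))} := by
  set c : ℝ := Real.exp (-4) / (2 * √(2 * Real.pi)) with hc
  have hc0 : 0 < c := by positivity
  have hlog2 : 0 < Real.log 2 := Real.log_pos (by norm_num)
  have hl2 : 0 < √(Real.log 2) := Real.sqrt_pos.2 hlog2
  refine ⟨8 / (c * √(Real.log 2)), by positivity, ?_⟩
  intro n hn hγn ε hε hε1 μ _ hμ
  have hn2 : (2 : ℝ) ≤ n := by exact_mod_cast hn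
  have hn0 : (0 : ℝ) < n := by linarith
  have hloglog : Real.log 2 ≤ Real.log n := Real.log_le_log (by norm_num) hn2
  obtain ⟨N, hcard, hunit, hnet⟩ := exists_finset_sphere_net n (16 * n ^ 2) (by positivity)
  have hnet' (x : EuclideanSpace ℝ (Fin n)) (hx : ‖x‖ = 1) :
      ∃ y ∈ N, ‖x - y‖ ≤ 1 / (16 * n) := by
    obtain ⟨y, hy, hxy⟩ := hnet x hx
    refine ⟨y, hy, hxy.trans ?_⟩
    have : √(n : ℝ) ≤ n := Real.sqrt_le_iff.2 ⟨hn0.le, by nlinarith⟩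
    push_cast
    rw [div_le_div_iff₀ (by positivity) (by positivity)]
    nlinarith
  set t := ⌈8 / (c * √(Real.log 2)) * (n : ℝ) ^ (2 * γ) * √(Real.log n) *
    (n * Real.log n + Real.log (1 / ε))⌉₊ with ht
  refine le_trans (ENNReal.ofReal_le_ofReal ?_) (pi_isHittingSet_ge N le_rfl (by positivity) hnet'
    (fun y hy => measure_cap_ge_rpow hn hγ hγn hμ (hunit y hy)) t)
  rw [← hc]
  have hlogε : 0 < Real.log (1 / ε) := Real.log_pos (by rw [lt_div_iff₀ hε]; linarith)
  set W := n * Real.log n + Real.log (1 / ε) with hW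
  have hW0 : 0 < W := by positivity
  have hqt : 8 * W ≤ c * (n : ℝ) ^ (-(2 * γ)) * t := by
    calc 8 * W = c * (n : ℝ) ^ (-(2 * γ)) *
          (8 / (c * √(Real.log 2)) * (n : ℝ) ^ (2 * γ) * √(Real.log 2) * W) := by
          rw [Real.rpow_neg hn0.le]
          have := Real.rpow_pos_of_pos hn0 (2 * γ)
          field_simp
      _ ≤ c * (n : ℝ) ^ (-(2 * γ)) *
          (8 / (c * √(Real.log 2)) * (n : ℝ) ^ (2 * γ) * √(Real.log n) * W) := by
          gcongr
      _ ≤ _ := by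
          gcongr
          exact Nat.le_ceil _
  have hcardN : (N.card : ℝ) ≤ Real.exp (8 * (n * Real.log n)) := by
    have hbase : 2 * (16 * n ^ 2) + 1 ≤ n ^ 8 := by
      have h64 : 2 ^ 6 ≤ n ^ 6 := Nat.pow_le_pow_left hn 6
      have h4 : 2 ^ 2 ≤ n ^ 2 := Nat.pow_le_pow_left hn 2
      calc 2 * (16 * n ^ 2) + 1 ≤ 2 ^ 6 * n ^ 2 := by omega
        _ ≤ n ^ 6 * n ^ 2 := Nat.mul_le_mul_right _ h64
        _ = n ^ 8 := by ring
    have h : N.card ≤ (n ^ 8) ^ n := hcard.trans (Nat.pow_le_pow_left hbase n)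
    calc (N.card : ℝ) ≤ ((n : ℝ) ^ 8) ^ n := by exact_mod_cast h
      _ = Real.exp (8 * (n * Real.log n)) := by
        rw [← pow_mul, ← Real.rpow_natCast, Real.rpow_def_of_pos hn0]
        push_cast
        ring_nf
  have hfinal : N.card * Real.exp (-(c * (n : ℝ) ^ (-(2 * γ))) * t) ≤ ε := by
    calc _ ≤ Real.exp (8 * (n * Real.log n)) * Real.exp (-(8 * W)) := by
          gcongr
          linarith
      _ = Real.exp (-(8 * Real.log (1 / ε))) := by
          rw [← Real.exp_add, hW]; ring_nf
      _ ≤ Real.exp (-Real.log (1 / ε)) := Real.exp_le_exp.2 (by linarith)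
      _ = ε := by rw [one_div, Real.log_inv, neg_neg, Real.exp_log hε]
  linarith
end

section
/- For every integer n ≥ 2 and every x ∈ ℝⁿ with ‖x‖ = 1 (Euclidean norm), there exists a nonempty subset D ⊆ {1, …, n} such that Σ_{i∈D} |x_i| ≥ (2/√(ln n + 5)) · √|D|. -/
open Finset in
/-- Abel summation: nonpositive partial sums stay nonpositive after weighting by a nonnegative
antitone sequence. -/
theorem sum_range_mul_nonpos_of_antitone {a u : ℕ → ℝ} (ha : Antitone a) (ha0 : ∀ i, 0 ≤ a i)
    {n : ℕ} (hu : ∀ k ≤ n, ∑ i ∈ range k, u i ≤ 0) : ∑ i ∈ range n, a i * u i ≤ 0 := by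
  have key : ∀ k ≤ n, ∑ i ∈ range k, a i * u i ≤ a k * ∑ i ∈ range k, u i := by
    intro k
    induction k with
    | zero => simp
    | succ k ih =>
      intro hk
      have hstep := mul_le_mul_of_nonpos_right (ha k.le_succ) (hu (k + 1) hk)
      have hprev := ih (by lia)
      rw [sum_range_succ] at hstep ⊢
      rw [sum_range_succ]
      simp only [Nat.succ_eq_add_one] at hstep
      linarith
  exact (key n le_rfl).trans (mul_nonpos_of_nonneg_of_nonpos (ha0 n) (hu n le_rfl))

open Finset in
/-- If the partial sums of a nonnegative antitone sequence are dominated by those of `b`, then its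
sum of squares is dominated by that of `b`. -/
theorem sum_range_sq_le_of_partial_sums_le {a b : ℕ → ℝ} (ha : Antitone a) (ha0 : ∀ i, 0 ≤ a i)
    {n : ℕ} (hab : ∀ k ≤ n, ∑ i ∈ range k, a i ≤ ∑ i ∈ range k, b i) :
    ∑ i ∈ range n, a i ^ 2 ≤ ∑ i ∈ range n, b i ^ 2 := by
  have habel : ∑ i ∈ range n, a i * (a i - b i) ≤ 0 :=
    sum_range_mul_nonpos_of_antitone ha ha0 fun k hk => by
      rw [sum_sub_distrib]
      linarith [hab k hk]
  have hsq : ∑ i ∈ range n, (a i ^ 2 - b i ^ 2) ≤ ∑ i ∈ range n, 2 * (a i * (a i - b i)) :=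
    sum_le_sum fun i _ => by nlinarith [sq_nonneg (a i - b i)]
  rw [← mul_sum, sum_sub_distrib] at hsq
  linarith

theorem sq_sqrt_succ_sub_sqrt_le {t : ℝ} (ht : 0 < t) :
    (√(t + 1) - √t) ^ 2 ≤ t⁻¹ / 4 := by
  have hs : 0 < √t := Real.sqrt_pos.mpr ht
  have hle : √t ≤ √(t + 1) := Real.sqrt_le_sqrt (by linarith)
  have h1 := Real.sq_sqrt ht.le
  have h2 := Real.sq_sqrt (show 0 ≤ t + 1 by linarith)
  have hprod : (√(t + 1) - √t) * (2 * √t) ≤ 1 := by nlinarith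
  have hsq : ((√(t + 1) - √t) * (2 * √t)) ^ 2 ≤ 1 :=
    pow_le_one₀ (mul_nonneg (sub_nonneg.mpr hle) (by positivity)) hprod
  rw [mul_pow, mul_pow, h1] at hsq
  rw [← one_div, div_div, le_div_iff₀ (by positivity)]
  linarith

open Finset in
theorem sum_range_sq_sqrt_succ_sub_sqrt_lt {n : ℕ} (hn : 2 ≤ n) :
    ∑ i ∈ range n, (√((i : ℝ) + 1) - √i) ^ 2 < (Real.log n + 5) / 4 := by
  obtain ⟨m, rfl⟩ : ∃ m, n = m + 1 := ⟨n - 1, by lia⟩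
  have hm : 0 < (m : ℝ) := by exact_mod_cast (by lia : 0 < m)
  have hterm : ∑ i ∈ range m, (√(((i + 1 : ℕ) : ℝ) + 1) - √((i + 1 : ℕ) : ℝ)) ^ 2
      ≤ ∑ i ∈ range m, (((i + 1 : ℕ) : ℝ))⁻¹ / 4 :=
    sum_le_sum fun i _ => sq_sqrt_succ_sub_sqrt_le (by positivity)
  have hharm : ∑ i ∈ range m, (((i + 1 : ℕ) : ℝ))⁻¹ ≤ 1 + Real.log m := by
    simpa [harmonic] using harmonic_le_one_add_log m
  have hlog : Real.log m < Real.log ((m + 1 : ℕ) : ℝ) :=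
    Real.log_lt_log hm (by push_cast; linarith)
  rw [← sum_div] at hterm
  rw [sum_range_succ']
  simp only [Nat.cast_zero, zero_add, Real.sqrt_one, Real.sqrt_zero, sub_zero, one_pow]
  linarith

open Finset in
/-- If every nonempty subset sum of `|y i|` over `D` is at most `c * √#D`, then `∑ y i ^ 2` is
at most `c ^ 2` times the sum of the squared increments of the square root. -/
theorem sum_sq_le_of_subset_sums_le {n : ℕ} {y : Fin n → ℝ} {c : ℝ}
    (hy : ∀ D : Finset (Fin n), D.Nonempty → ∑ i ∈ D, |y i| ≤ c * √(#D : ℝ)) :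
    ∑ i, y i ^ 2 ≤ c ^ 2 * ∑ i ∈ range n, (√((i : ℝ) + 1) - √i) ^ 2 := by
  set σ := Tuple.sort fun i => -|y i|
  have hmono : Monotone fun i => -|y (σ i)| := Tuple.monotone_sort fun i => -|y i|
  set a : ℕ → ℝ := fun i => if h : i < n then |y (σ ⟨i, h⟩)| else 0 with ha
  have ha0 : ∀ i, 0 ≤ a i := fun i => by
    simp only [ha]
    split_ifs <;> positivity
  have hanti : Antitone a := fun i j hij => by
    by_cases hj : j < n
    · have hi : i < n := by lia
      have := hmono (show (⟨i, hi⟩ : Fin n) ≤ ⟨j, hj⟩ from hij)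
      simp only [ha, hi, hj, dite_true]
      linarith
    · simpa [ha, hj] using ha0 i
  have hpartial : ∀ k ≤ n, ∑ i ∈ range k, a i
      ≤ ∑ i ∈ range k, c * (√((i : ℝ) + 1) - √i) := by
    intro k hk
    have htel : ∑ i ∈ range k, c * (√((i : ℝ) + 1) - √i) = c * √k := by
      rw [← mul_sum]
      simpa using congrArg (c * ·) (sum_range_sub (fun i : ℕ => √(i : ℝ)) k)
    rw [htel, Finset.sum_range]
    rcases Nat.eq_zero_or_pos k with rfl | hk0
    · simp
    · have : Nonempty (Fin k) := ⟨⟨0, hk0⟩⟩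
      have hD := hy (univ.map ((Fin.castLEEmb hk).trans σ.toEmbedding)) (univ_nonempty.map)
      rw [sum_map, card_map, card_univ, Fintype.card_fin] at hD
      refine le_trans (le_of_eq (sum_congr rfl fun i _ => ?_)) hD
      have hi : (i : ℕ) < n := i.2.trans_le hk
      simp only [ha, hi, dite_true]
      rfl
  have hsq := sum_range_sq_le_of_partial_sums_le hanti ha0 hpartial
  have hsum : ∑ i ∈ range n, a i ^ 2 = ∑ i, y i ^ 2 := by
    rw [Finset.sum_range, ← Equiv.sum_comp σ fun i => y i ^ 2]
    exact sum_congr rfl fun i _ => by simp [ha]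
  simpa only [hsum, mul_pow, ← mul_sum] using hsq

/-- For every integer `n ≥ 2` and every unit vector `x ∈ ℝⁿ`, there exists a
nonempty subset `D ⊆ {1, …, n}` such that `Σ_{i∈D} |x_i| ≥ (2/√(ln n + 5)) · √|D|`. -/
theorem stmt1 (n : ℕ) (hn : 2 ≤ n) (x : EuclideanSpace ℝ (Fin n)) (hx : ‖x‖ = 1) :
    ∃ D : Finset (Fin n), D.Nonempty ∧
      2 / Real.sqrt (Real.log n + 5) * Real.sqrt (D.card) ≤ ∑ i ∈ D, |x i| := by
  by_contra! h
  have hlog : 0 < Real.log n + 5 := by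
    have : 0 ≤ Real.log n := Real.log_natCast_nonneg n
    linarith
  have hle := sum_sq_le_of_subset_sums_le (y := fun i => x i) fun D hD => (h D hD).le
  have hone : ∑ i, x i ^ 2 = 1 := by
    rw [← EuclideanSpace.real_norm_sq_eq, hx, one_pow]
  rw [hone, div_pow, Real.sq_sqrt hlog.le] at hle
  have hlt := mul_lt_mul_of_pos_left (sum_range_sq_sqrt_succ_sub_sqrt_lt hn)
    (show 0 < 2 ^ 2 / (Real.log n + 5) by positivity)
  have heq : 2 ^ 2 / (Real.log n + 5) * ((Real.log n + 5) / 4) = 1 := by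
    field_simp
    norm_num
  linarith
end

section
/- For every integer n ≥ 2 and every x ∈ ℝⁿ with ‖x‖ = 1, there exists z ∈ {−1, 0, 1}ⁿ with z ≠ 0 such that ⟨x, z⟩ / ‖z‖ ≥ 2/√(ln n + 5). Consequently, the set H₂ⁿ = {z/‖z‖ : z ∈ {−1,0,1}ⁿ, z ≠ 0} is a 2/√(ln n + 5)-hitting set of Sⁿ of cardinality less than 3ⁿ. -/
open scoped RealInnerProductSpace

/-- Abel summation: weighting by a nonnegative antitone sequence preserves nonnegativity of
partial sums. -/
theorem sum_mul_nonneg_of_partial_sums_nonneg {a w : ℕ → ℝ} (ha : Antitone a) (n : ℕ)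
    (ha0 : 0 ≤ a n) (hw : ∀ k ≤ n, 0 ≤ ∑ j ∈ Finset.range k, w j) :
    0 ≤ ∑ j ∈ Finset.range n, a j * w j := by
  have key : ∀ k ≤ n, a k * ∑ j ∈ Finset.range k, w j ≤ ∑ j ∈ Finset.range k, a j * w j := by
    intro k
    induction k with
    | zero => simp
    | succ k ih =>
      intro hk
      calc a (k + 1) * ∑ j ∈ Finset.range (k + 1), w j
          ≤ a k * ∑ j ∈ Finset.range (k + 1), w j :=
            mul_le_mul_of_nonneg_right (ha k.le_succ) (hw _ hk)
        _ = a k * ∑ j ∈ Finset.range k, w j + a k * w k := by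
            rw [Finset.sum_range_succ, mul_add]
        _ ≤ ∑ j ∈ Finset.range (k + 1), a j * w j := by
            rw [Finset.sum_range_succ]
            linarith [ih (by omega)]
  exact (mul_nonneg ha0 (hw n le_rfl)).trans (key n le_rfl)

theorem sq_sqrt_succ_sub_sqrt_le_s4 {k : ℕ} (hk : 0 < k) :
    (√((k + 1 : ℕ) : ℝ) - √(k : ℝ)) ^ 2 ≤ 1 / (4 * k) := by
  have hk' : (0 : ℝ) < k := by exact_mod_cast hk
  have h1 : √((k + 1 : ℕ) : ℝ) ^ 2 = k + 1 := by
    rw [Real.sq_sqrt (by positivity)]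
    push_cast
    rfl
  have h2 : √(k : ℝ) ^ 2 = k := Real.sq_sqrt hk'.le
  have h3 : √(k : ℝ) ≤ √((k + 1 : ℕ) : ℝ) := Real.sqrt_le_sqrt (by push_cast; linarith)
  have h4 : 0 ≤ √(k : ℝ) := Real.sqrt_nonneg _
  set s := √((k + 1 : ℕ) : ℝ)
  set t := √(k : ℝ)
  rw [le_div_iff₀ (by positivity)]
  have h5 : (s - t) * (2 * t) ≤ 1 := by nlinarith
  have h6 : 0 ≤ (s - t) * (2 * t) := mul_nonneg (by linarith) (by linarith)
  calc (s - t) ^ 2 * (4 * k) = ((s - t) * (2 * t)) ^ 2 := by rw [← h2]; ring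
    _ ≤ 1 := pow_le_one₀ h6 h5

theorem sum_sq_sqrt_succ_sub_sqrt_le (m : ℕ) :
    ∑ j ∈ Finset.range (m + 2), (√((j + 1 : ℕ) : ℝ) - √(j : ℝ)) ^ 2
      ≤ (Real.log (m + 1 : ℕ) + 5) / 4 := by
  induction m with
  | zero =>
    have h := sq_sqrt_succ_sub_sqrt_le_s4 one_pos
    rw [Finset.sum_range_succ, Finset.sum_range_one]
    norm_num at h ⊢
    linarith
  | succ m ih =>
    rw [Finset.sum_range_succ]
    have h := sq_sqrt_succ_sub_sqrt_le_s4 (Nat.succ_pos (m + 1))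
    have hlog : 1 / ((m + 2 : ℕ) : ℝ) ≤ Real.log (m + 2 : ℕ) - Real.log (m + 1 : ℕ) := by
      rw [← Real.log_div (by positivity) (by positivity)]
      refine le_trans (le_of_eq ?_) (Real.one_sub_inv_le_log_of_pos (by positivity))
      push_cast
      field_simp
      ring
    have h' : 1 / (4 * ((m + 2 : ℕ) : ℝ)) = 1 / ((m + 2 : ℕ) : ℝ) / 4 := by
      field_simp
    change _ ≤ (Real.log (m + 2 : ℕ) + 5) / 4
    change _ ≤ 1 / (4 * ((m + 2 : ℕ) : ℝ)) at h
    rw [h'] at h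
    linarith

/-- An antitone nonnegative sequence with unit sum of squares has a large normalized partial sum. -/
theorem exists_le_partial_sum_of_antitone {a : ℕ → ℝ} (ha : Antitone a) (ha0 : ∀ k, 0 ≤ a k)
    {n : ℕ} (hn : 2 ≤ n) (hsum : ∑ j ∈ Finset.range n, a j ^ 2 = 1) :
    ∃ k, 0 < k ∧ k ≤ n ∧
      2 / √(Real.log n + 5) * √(k : ℝ) ≤ ∑ j ∈ Finset.range k, a j := by
  by_contra! hcon
  have hL : 0 < Real.log n + 5 := by
    have := Real.log_natCast_nonneg n
    linarith
  set τ := 2 / √(Real.log n + 5) with hτ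
  have hτ2 : τ ^ 2 * ((Real.log n + 5) / 4) = 1 := by
    rw [hτ, div_pow, Real.sq_sqrt hL.le]
    field_simp
    norm_num
  have hτ0 : 0 < τ := by positivity
  set d : ℕ → ℝ := fun j => √((j + 1 : ℕ) : ℝ) - √(j : ℝ) with hd
  have hD : ∑ j ∈ Finset.range n, d j ^ 2 < (Real.log n + 5) / 4 := by
    obtain ⟨m, rfl⟩ := Nat.exists_eq_add_of_le' hn
    refine (sum_sq_sqrt_succ_sub_sqrt_le m).trans_lt ?_
    have : Real.log (m + 1 : ℕ) < Real.log (m + 2 : ℕ) :=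
      Real.log_lt_log (by positivity) (by push_cast; linarith)
    linarith
  have habel := sum_mul_nonneg_of_partial_sums_nonneg (w := fun j => τ * d j - a j) ha n (ha0 n) (by
    intro k hk
    rw [Finset.sum_sub_distrib, ← Finset.mul_sum, hd, Finset.sum_range_sub (fun j => √(j : ℝ))]
    rcases Nat.eq_zero_or_pos k with rfl | hk0
    · simp
    · have := hcon k hk0 hk
      simp only [Nat.cast_zero, Real.sqrt_zero, sub_zero]
      linarith)
  have h1 : 1 ≤ τ * ∑ j ∈ Finset.range n, a j * d j := by
    rw [← hsum, Finset.mul_sum, ← sub_nonneg, ← Finset.sum_sub_distrib]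
    refine habel.trans_eq (Finset.sum_congr rfl fun j _ => ?_)
    ring
  have hcs := Finset.sum_mul_sq_le_sq_mul_sq (Finset.range n) a d
  rw [hsum, one_mul] at hcs
  have h2 : 1 ≤ τ ^ 2 * (∑ j ∈ Finset.range n, a j * d j) ^ 2 := by
    rw [← mul_pow]
    exact one_le_pow₀ h1
  have h3 : τ ^ 2 * (∑ j ∈ Finset.range n, a j * d j) ^ 2 < 1 := by
    rw [← hτ2]
    exact mul_lt_mul_of_pos_left (hcs.trans_lt hD) (by positivity)
  linarith

/-- Every unit vector has a large normalized inner product with a nonzero `{-1, 0, 1}` vector. -/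
theorem exists_sign_vector_inner_ge {n : ℕ} (hn : 2 ≤ n) (x : EuclideanSpace ℝ (Fin n))
    (hx : ‖x‖ = 1) :
    ∃ z : EuclideanSpace ℝ (Fin n), (∀ i, z i = -1 ∨ z i = 0 ∨ z i = 1) ∧ z ≠ 0 ∧
      2 / √(Real.log n + 5) ≤ ⟪x, z⟫ / ‖z‖ := by
  set σ := Tuple.sort fun i => -|x i|
  have hσ : Monotone fun j => -|x (σ j)| := Tuple.monotone_sort fun i => -|x i|
  set a : ℕ → ℝ := fun k => if h : k < n then |x (σ ⟨k, h⟩)| else 0 with ha_def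
  have ha0 : ∀ k, 0 ≤ a k := by
    intro k
    simp only [ha_def]
    split_ifs <;> positivity
  have ha : Antitone a := by
    intro k l hkl
    by_cases hl : l < n
    · have hk : k < n := hkl.trans_lt hl
      simpa [ha_def, hl, hk] using hσ (show (⟨k, hk⟩ : Fin n) ≤ ⟨l, hl⟩ from hkl)
    · simpa [ha_def, hl] using ha0 k
  have haσ : ∀ j : Fin n, a j = |x (σ j)| := fun j => by simp [ha_def]
  have hsum : ∑ j ∈ Finset.range n, a j ^ 2 = 1 := by
    rw [← Fin.sum_univ_eq_sum_range (fun j => a j ^ 2) n]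
    simp only [haσ, sq_abs]
    rw [Equiv.sum_comp σ (fun i => x i ^ 2), ← EuclideanSpace.real_norm_sq_eq, hx, one_pow]
  obtain ⟨k, hk0, hkn, hk⟩ := exists_le_partial_sum_of_antitone ha ha0 hn hsum
  have hfilter : ∀ f : ℕ → ℝ,
      ∑ j : Fin n, (if (j : ℕ) < k then f j else 0) = ∑ j ∈ Finset.range k, f j := by
    intro f
    rw [Fin.sum_univ_eq_sum_range (fun j => if j < k then f j else 0) n, ← Finset.sum_filter]
    congr 1
    ext j
    simp only [Finset.mem_filter, Finset.mem_range]
    omega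
  set z : EuclideanSpace ℝ (Fin n) := WithLp.toLp 2 fun i =>
    if (σ.symm i : ℕ) < k then (if 0 ≤ x i then 1 else -1) else 0
  have hzi : ∀ i, z i = if (σ.symm i : ℕ) < k then (if 0 ≤ x i then 1 else -1) else 0 :=
    fun i => rfl
  have hnorm : ‖z‖ = √(k : ℝ) := by
    rw [← Real.sqrt_sq (norm_nonneg z), EuclideanSpace.real_norm_sq_eq,
      ← Equiv.sum_comp σ (fun i => z i ^ 2)]
    congr 1
    have h := hfilter fun _ => 1
    simp only [Finset.sum_const, Finset.card_range, nsmul_eq_mul, mul_one] at h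
    rw [← h]
    refine Finset.sum_congr rfl fun j _ => ?_
    rw [hzi, Equiv.symm_apply_apply]
    split_ifs <;> norm_num
  have hinner : ⟪x, z⟫ = ∑ j ∈ Finset.range k, a j := by
    rw [← hfilter, PiLp.inner_apply, ← Equiv.sum_comp σ]
    refine Finset.sum_congr rfl fun j _ => ?_
    rw [hzi, Equiv.symm_apply_apply, haσ]
    split_ifs with h1 h2
    · simp [abs_of_nonneg h2]
    · simp [abs_of_neg (not_le.mp h2)]
    · simp
  have hk' : 0 < √(k : ℝ) := Real.sqrt_pos.mpr (by exact_mod_cast hk0)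
  refine ⟨z, fun i => ?_, ?_, ?_⟩
  · rw [hzi]
    split_ifs <;> simp
  · rw [← norm_pos_iff, hnorm]
    exact hk'
  · rw [hnorm, hinner, le_div_iff₀ hk']
    exact hk

theorem encard_normalized_sign_vectors_lt (n : ℕ) :
    {w : EuclideanSpace ℝ (Fin n) | ∃ z : EuclideanSpace ℝ (Fin n),
        (∀ i, z i = -1 ∨ z i = 0 ∨ z i = 1) ∧ z ≠ 0 ∧ w = ‖z‖⁻¹ • z}.encard
      < ((3 ^ n : ℕ) : ℕ∞) := by
  let v : (Fin n → SignType) → EuclideanSpace ℝ (Fin n) := fun f => WithLp.toLp 2 fun i => (f i : ℝ)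
  have hsub : {w : EuclideanSpace ℝ (Fin n) | ∃ z : EuclideanSpace ℝ (Fin n),
      (∀ i, z i = -1 ∨ z i = 0 ∨ z i = 1) ∧ z ≠ 0 ∧ w = ‖z‖⁻¹ • z} ⊆
      (fun f => ‖v f‖⁻¹ • v f) '' {f | f ≠ 0} := by
    rintro w ⟨z, hz, hz0, rfl⟩
    have hv : v (fun i => SignType.sign (z i)) = z := by
      ext i
      change ((SignType.sign (z i) : SignType) : ℝ) = z i
      rcases hz i with h | h | h <;> simp [h]
    refine ⟨fun i => SignType.sign (z i), fun h => hz0 ?_, ?_⟩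
    · rw [← hv, h]
      ext i
      simp [v]
    · simp only [hv]
  calc _ ≤ _ := Set.encard_le_encard hsub
    _ ≤ _ := Set.encard_image_le _ _
    _ < (Set.univ : Set (Fin n → SignType)).encard :=
        (Set.toFinite _).encard_lt_encard ((Set.ssubset_univ_iff).mpr fun h =>
          (h ▸ Set.mem_univ (0 : Fin n → SignType) : (0 : Fin n → SignType) ∈ {f | f ≠ 0}) rfl)
    _ = _ := by
        rw [Set.encard_univ, ENat.card_eq_coe_fintype_card, Fintype.card_fun, Fintype.card_fin]
        rfl

/-- For every `n ≥ 2` and every unit vector `x ∈ ℝⁿ`, there exists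
`z ∈ {−1,0,1}ⁿ`, `z ≠ 0`, with `⟨x, z⟩/‖z‖ ≥ 2/√(ln n + 5)`. Consequently
`H₂ⁿ = {z/‖z‖ : z ∈ {−1,0,1}ⁿ, z ≠ 0}` is a `2/√(ln n + 5)`-hitting set of `Sⁿ` of
cardinality less than `3ⁿ`. -/
theorem stmt4 (n : ℕ) (hn : 2 ≤ n) :
    (∀ x : EuclideanSpace ℝ (Fin n), ‖x‖ = 1 →
        ∃ z : EuclideanSpace ℝ (Fin n), (∀ i, z i = -1 ∨ z i = 0 ∨ z i = 1) ∧ z ≠ 0 ∧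
          2 / Real.sqrt (Real.log n + 5) ≤ ⟪x, z⟫ / ‖z‖) ∧
    IsHittingSet
      {w : EuclideanSpace ℝ (Fin n) | ∃ z : EuclideanSpace ℝ (Fin n),
        (∀ i, z i = -1 ∨ z i = 0 ∨ z i = 1) ∧ z ≠ 0 ∧ w = ‖z‖⁻¹ • z}
      (2 / Real.sqrt (Real.log n + 5)) ∧
    {w : EuclideanSpace ℝ (Fin n) | ∃ z : EuclideanSpace ℝ (Fin n),
        (∀ i, z i = -1 ∨ z i = 0 ∨ z i = 1) ∧ z ≠ 0 ∧ w = ‖z‖⁻¹ • z}.encard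
      < ((3 ^ n : ℕ) : ℕ∞) := by
  refine ⟨exists_sign_vector_inner_ge hn, ⟨?_, fun x hx => ?_⟩,
    encard_normalized_sign_vectors_lt n⟩
  · rintro w ⟨z, -, hz0, rfl⟩
    rw [norm_smul, norm_inv, norm_norm, inv_mul_cancel₀ (norm_ne_zero_iff.mpr hz0)]
  · obtain ⟨z, hz, hz0, h⟩ := exists_sign_vector_inner_ge hn x hx
    refine ⟨_, ⟨z, hz, hz0, rfl⟩, ?_⟩
    rwa [inner_smul_right, mul_comm, ← div_eq_mul_inv]
end

section
/- Let α ≥ 1 and β ≥ α + 1 be real numbers, let n ≥ 2 be an integer, and set m = ⌈log_β(αn)⌉. Then for every x ∈ ℝⁿ with ‖x‖ = 1 there exists a vector z ∈ ℝⁿ such that: (i) for every index i there is some k ∈ {1, …, m} with |z_i| = β^{(k−1)/2}; (ii) for each k ∈ {2, …, m}, the number of indices i with |z_i| = β^{(k−1)/2} is at most ⌊αn/β^{k−1}⌋; and (iii) ⟨z, x⟩ ≥ ((α−1)/√(αβ(α+1))) · ‖z‖. -/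
open scoped RealInnerProductSpace

/-- Rounding up to a power of `β`: the exponent can be chosen between `1` and `⌈log_β N⌉`. -/
lemma exists_zpow_bracket {β t N : ℝ} (hβ : 1 < β) (hN : 1 < N) (ht : t ≤ N) :
    ∃ k : ℤ, 1 ≤ k ∧ k ≤ ⌈Real.logb β N⌉ ∧ t ≤ β ^ k ∧ β ^ (k - 1) ≤ max 1 t := by
  rcases le_or_gt t 1 with h1 | h1
  · exact ⟨1, le_rfl, Int.one_le_ceil_iff.2 (Real.logb_pos hβ hN), by simpa using h1.trans hβ.le,
      by simp⟩
  · have ht0 : 0 < t := one_pos.trans h1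
    have hβ0 : 0 < β := one_pos.trans hβ
    refine ⟨⌈Real.logb β t⌉, Int.one_le_ceil_iff.2 (Real.logb_pos hβ h1),
      Int.ceil_mono (Real.logb_le_logb_of_le hβ ht0 ht), ?_, le_max_of_le_right ?_⟩
    · rw [← Real.rpow_intCast, ← Real.logb_le_iff_le_rpow hβ ht0]
      exact Int.le_ceil _
    · rw [← Real.rpow_intCast, ← Real.le_logb_iff_rpow_le hβ ht0]
      push_cast
      linarith [Int.ceil_lt_add_one (Real.logb β t)]

/-- Let `α ≥ 1`, `β ≥ α + 1`, `n ≥ 2`, and `m = ⌈log_β(αn)⌉`. For every unit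
vector `x ∈ ℝⁿ` there exists `z ∈ ℝⁿ` such that: (i) every `|z_i|` equals `β^{(k−1)/2}` for
some `k ∈ {1,…,m}`; (ii) for each `k ∈ {2,…,m}` the number of indices `i` with
`|z_i| = β^{(k−1)/2}` is at most `⌊αn/β^{k−1}⌋`; and (iii)
`⟨z, x⟩ ≥ ((α−1)/√(αβ(α+1)))·‖z‖`. -/
theorem stmt5 (α β : ℝ) (hα : 1 ≤ α) (hβ : α + 1 ≤ β) (n : ℕ) (hn : 2 ≤ n)
    (x : EuclideanSpace ℝ (Fin n)) (hx : ‖x‖ = 1) :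
    ∃ z : EuclideanSpace ℝ (Fin n),
      (∀ i, ∃ k : ℤ, 1 ≤ k ∧ k ≤ ⌈Real.logb β (α * n)⌉ ∧
        |z i| = Real.sqrt (β ^ (k - 1))) ∧
      (∀ k : ℤ, 2 ≤ k → k ≤ ⌈Real.logb β (α * n)⌉ →
        (({i : Fin n | |z i| = Real.sqrt (β ^ (k - 1))}.ncard : ℤ)) ≤
          ⌊α * n / β ^ (k - 1)⌋) ∧
      (α - 1) / Real.sqrt (α * β * (α + 1)) * ‖z‖ ≤ ⟪z, x⟫ := by
  have hn' : (2 : ℝ) ≤ n := by exact_mod_cast hn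
  have hβ1 : 1 < β := by linarith
  have hβ0 : 0 < β := by linarith
  have hα0 : 0 < α := by linarith
  have hN : 1 < α * n := by nlinarith
  have hsum : ∑ i, x i ^ 2 = 1 := by
    rw [← EuclideanSpace.real_norm_sq_eq, hx, one_pow]
  have hxi (i : Fin n) : x i ^ 2 ≤ 1 :=
    hsum ▸ Finset.single_le_sum (f := fun i => x i ^ 2) (fun j _ => sq_nonneg _)
      (Finset.mem_univ i)
  have hsumN : ∑ i, α * n * x i ^ 2 = α * n := by rw [← Finset.mul_sum, hsum, mul_one]
  choose k hk1 hkm hlow hup using fun i => exists_zpow_bracket (t := α * n * x i ^ 2) hβ1 hN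
    (mul_le_of_le_one_right (by linarith) (hxi i))
  let z : EuclideanSpace ℝ (Fin n) :=
    WithLp.toLp 2 fun i => (if x i < 0 then -1 else 1) * Real.sqrt (β ^ (k i - 1))
  have hz (i : Fin n) : |z i| = Real.sqrt (β ^ (k i - 1)) := by
    simp only [z]
    split_ifs <;> simp [abs_of_nonneg]
  have hzx (i : Fin n) : z i * x i = Real.sqrt (β ^ (k i - 1)) * |x i| := by
    simp only [z]
    split_ifs with h
    · rw [abs_of_neg h]; ring
    · rw [abs_of_nonneg (not_lt.1 h)]; ring
  refine ⟨z, fun i => ⟨k i, hk1 i, hkm i, hz i⟩, fun l hl _ => ?_, ?_⟩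
  · have hpow : 0 < β ^ (l - 1) := by positivity
    rw [Int.le_floor, le_div_iff₀ hpow, Set.ncard_eq_toFinset_card', Int.cast_natCast,
      ← nsmul_eq_mul]
    refine (Finset.card_nsmul_le_sum _ (fun i => α * n * x i ^ 2) _ fun i hi => ?_).trans
      ((Finset.sum_le_univ_sum_of_nonneg fun i => by positivity).trans hsumN.le)
    have hi' : Real.sqrt (β ^ (k i - 1)) = Real.sqrt (β ^ (l - 1)) := by
      rw [← hz i]; simpa using hi
    rw [Real.sqrt_inj (by positivity) hpow.le] at hi'
    exact (le_max_iff.1 (hi' ▸ hup i)).resolve_left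
      (not_le.2 (one_lt_zpow₀ hβ1 (by lia)))
  · have hnorm : ‖z‖ ≤ Real.sqrt ((α + 1) * n) := by
      refine Real.le_sqrt_of_sq_le ?_
      rw [EuclideanSpace.real_norm_sq_eq]
      calc ∑ i, z i ^ 2 ≤ ∑ i, (1 + α * n * x i ^ 2) := by
            refine Finset.sum_le_sum fun i _ => ?_
            rw [← sq_abs, hz, Real.sq_sqrt (by positivity)]
            exact (hup i).trans (max_le_add_of_nonneg zero_le_one (by positivity))
        _ = (α + 1) * n := by
            rw [Finset.sum_add_distrib, hsumN]
            simp
            ring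
    have hinner : Real.sqrt (α * n / β) ≤ ⟪z, x⟫ := by
      calc Real.sqrt (α * n / β) = ∑ i, Real.sqrt (α * n / β) * x i ^ 2 := by
            rw [← Finset.mul_sum, hsum, mul_one]
        _ ≤ ∑ i, z i * x i := by
            refine Finset.sum_le_sum fun i _ => ?_
            rw [hzx, ← sq_abs, sq, ← mul_assoc]
            refine mul_le_mul_of_nonneg_right ?_ (abs_nonneg _)
            rw [← Real.sqrt_sq_eq_abs, ← Real.sqrt_mul (by positivity)]
            refine Real.sqrt_le_sqrt ?_
            rw [zpow_sub_one₀ hβ0.ne', div_mul_eq_mul_div, div_eq_mul_inv]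
            exact mul_le_mul_of_nonneg_right (hlow i) (by positivity)
        _ = ⟪z, x⟫ := by
            simp [PiLp.inner_apply, mul_comm]
    refine le_trans ?_ hinner
    calc (α - 1) / Real.sqrt (α * β * (α + 1)) * ‖z‖
        ≤ α / Real.sqrt (α * β * (α + 1)) * Real.sqrt ((α + 1) * n) := by
          gcongr
          linarith
      _ = Real.sqrt (α * n / β) := by
          symm
          rw [Real.sqrt_eq_iff_mul_self_eq (by positivity) (by positivity), ← sq, mul_pow, div_pow,
            Real.sq_sqrt (by positivity), Real.sq_sqrt (by positivity)]
          field_simp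
end

section
/- There exist constants c > 0 and C > 0 such that for every integer n ≥ 3 there exists a finite τ-hitting set H ⊆ Sⁿ with τ ≥ c·√(ln n/(n · ln ln n)) and |H| ≤ C·n^{1 + ln 3}. -/
open scoped RealInnerProductSpace

open Finset

/-- If every nonempty `S ⊆ W` satisfies `∑_{i ∈ S} |y i| ≤ τ √|S|`, then the squared `ℓ²`-norm
of `y` on `W` is at most `τ²` times the harmonic number of `|W|`. -/
lemma sum_sq_le_sq_mul_harmonic {ι : Type*} [DecidableEq ι] (y : ι → ℝ) (τ : ℝ)
    (W : Finset ι)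
    (hW : ∀ S ⊆ W, S.Nonempty → ∑ i ∈ S, |y i| ≤ τ * √(#S : ℝ)) :
    ∑ i ∈ W, y i ^ 2 ≤ τ ^ 2 * (harmonic #W : ℝ) := by
  induction hk : #W generalizing W with
  | zero => simp [Finset.card_eq_zero.mp hk]
  | succ k ih =>
    have hne : W.Nonempty := Finset.card_pos.mp (by omega)
    obtain ⟨m, hm, hmin⟩ := W.exists_min_image (fun i => |y i|) hne
    have herase := ih (W.erase m) (fun S hS => hW S (hS.trans (W.erase_subset m)))
      (by rw [Finset.card_erase_of_mem hm, hk]; rfl)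
    have hsum : (k + 1 : ℝ) * |y m| ≤ τ * √(k + 1 : ℝ) := by
      have h₁ := Finset.card_nsmul_le_sum W (fun i => |y i|) |y m| hmin
      have h₂ := hW W subset_rfl hne
      rw [hk] at h₁ h₂
      push_cast [nsmul_eq_mul] at h₁ h₂
      exact h₁.trans h₂
    have hmsq : y m ^ 2 ≤ τ ^ 2 * (k + 1 : ℝ)⁻¹ := by
      have hpos : (0 : ℝ) < k + 1 := by positivity
      have hsq := pow_le_pow_left₀ (by positivity) hsum 2
      rw [mul_pow, mul_pow, sq_abs, Real.sq_sqrt hpos.le] at hsq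
      rw [← div_eq_mul_inv, le_div_iff₀ hpos]
      nlinarith
    rw [← Finset.add_sum_erase W _ hm, harmonic_succ]
    push_cast
    linarith

/-- The cyclic window of length `k` in `Fin n` starting at `a`. -/
def cyclicWindow {n : ℕ} [NeZero n] (k : ℕ) (a : Fin n) : Finset (Fin n) :=
  (Finset.range k).image fun j => Fin.ofNat n j + a

lemma injOn_ofNat_add {n : ℕ} [NeZero n] {k : ℕ} (hk : k ≤ n) (a : Fin n) :
    Set.InjOn (fun j => Fin.ofNat n j + a) (Finset.range k : Set ℕ) := by
  intro i hi j hj hij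
  simp only [Finset.coe_range, Set.mem_Iio] at hi hj
  have h := congrArg Fin.val (add_right_cancel hij)
  simpa [Fin.ofNat, Nat.mod_eq_of_lt (hi.trans_le hk), Nat.mod_eq_of_lt (hj.trans_le hk)] using h

lemma card_cyclicWindow {n : ℕ} [NeZero n] {k : ℕ} (hk : k ≤ n) (a : Fin n) :
    #(cyclicWindow k a) = k := by
  rw [cyclicWindow, Finset.card_image_of_injOn (injOn_ofNat_add hk a), Finset.card_range]

lemma sum_sum_cyclicWindow {n : ℕ} [NeZero n] {k : ℕ} (hk : k ≤ n) (f : Fin n → ℝ) :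
    ∑ a, ∑ i ∈ cyclicWindow k a, f i = k * ∑ i, f i := by
  calc ∑ a, ∑ i ∈ cyclicWindow k a, f i
      = ∑ a, ∑ j ∈ Finset.range k, f (Fin.ofNat n j + a) :=
        Finset.sum_congr rfl fun a _ => Finset.sum_image (injOn_ofNat_add hk a)
    _ = ∑ j ∈ Finset.range k, ∑ a, f (Fin.ofNat n j + a) := Finset.sum_comm
    _ = ∑ j ∈ Finset.range k, ∑ i, f i :=
        Finset.sum_congr rfl fun j _ => Equiv.sum_comp (Equiv.addLeft (Fin.ofNat n j)) f
    _ = k * ∑ i, f i := by simp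

/-- Some cyclic window carries at least the average share of the mass of a unit vector. -/
lemma exists_div_le_sum_cyclicWindow {n : ℕ} [NeZero n] {k : ℕ} (hk : k ≤ n)
    (x : EuclideanSpace ℝ (Fin n)) (hx : ‖x‖ = 1) :
    ∃ a : Fin n, (k / n : ℝ) ≤ ∑ i ∈ cyclicWindow k a, x i ^ 2 := by
  have hone : ∑ i, x i ^ 2 = 1 := by rw [← EuclideanSpace.real_norm_sq_eq, hx, one_pow]
  have hn : (n : ℝ) ≠ 0 := by exact_mod_cast NeZero.ne n
  have hsum : ∑ _a : Fin n, (k / n : ℝ) ≤ ∑ a, ∑ i ∈ cyclicWindow k a, x i ^ 2 := by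
    rw [sum_sum_cyclicWindow hk, hone]
    simp [mul_div_cancel₀ _ hn]
  obtain ⟨a, -, ha⟩ := Finset.exists_le_of_sum_le Finset.univ_nonempty hsum
  exact ⟨a, ha⟩

/-- The vector with entries in `{-1, 0, 1}` prescribed by `s`. -/
noncomputable def signVector {n : ℕ} (s : Fin n → SignType) : EuclideanSpace ℝ (Fin n) :=
  WithLp.toLp 2 fun i => (s i : ℝ)

/-- The sign patterns supported in a cyclic window of length `k`. -/
def windowPatterns (n k : ℕ) [NeZero n] : Finset (Fin n → SignType) :=
  Finset.univ.biUnion fun a : Fin n =>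
    Fintype.piFinset fun i => if i ∈ cyclicWindow k a then Finset.univ else {0}

lemma card_windowPatterns_le {n : ℕ} [NeZero n] {k : ℕ} (hk : k ≤ n) :
    #(windowPatterns n k) ≤ n * 3 ^ k := by
  refine (Finset.card_biUnion_le_card_mul _ _ (3 ^ k) fun a _ => ?_).trans_eq (by simp)
  have hcard : ∀ i, #(if i ∈ cyclicWindow k a then (Finset.univ : Finset SignType) else {0}) =
      if i ∈ cyclicWindow k a then 3 else 1 := by
    intro i
    split_ifs <;> rfl
  simp only [Fintype.card_piFinset, hcard]
  rw [Finset.prod_ite_mem, Finset.univ_inter, Finset.prod_const, card_cyclicWindow hk]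

/-- The normalized nonzero vectors with entries in `{-1, 0, 1}` supported in a cyclic window of
length `k`. -/
def windowSignVectors (n k : ℕ) [NeZero n] : Set (EuclideanSpace ℝ (Fin n)) :=
  (fun s => ‖signVector s‖⁻¹ • signVector s) '' {s | s ∈ windowPatterns n k ∧ s ≠ 0}

lemma finite_windowSignVectors (n k : ℕ) [NeZero n] : (windowSignVectors n k).Finite :=
  (Set.toFinite _).image _

lemma ncard_windowSignVectors_le {n : ℕ} [NeZero n] {k : ℕ} (hk : k ≤ n) :
    (windowSignVectors n k).ncard ≤ n * 3 ^ k :=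
  calc (windowSignVectors n k).ncard
      ≤ {s | s ∈ windowPatterns n k ∧ s ≠ 0}.ncard := Set.ncard_image_le (Set.toFinite _)
    _ ≤ (windowPatterns n k : Set (Fin n → SignType)).ncard :=
        Set.ncard_le_ncard (fun _ hs => hs.1) (Set.toFinite _)
    _ ≤ n * 3 ^ k := by
        rw [Set.ncard_coe_finset]
        exact card_windowPatterns_le hk

lemma signVector_ne_zero {n : ℕ} {s : Fin n → SignType} (hs : s ≠ 0) : signVector s ≠ 0 := by
  obtain ⟨i, hi⟩ := Function.ne_iff.mp hs
  intro h
  have hval : (s i : ℝ) = 0 := congrArg (fun v : EuclideanSpace ℝ (Fin n) => v i) h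
  cases hsi : s i <;> simp_all

/-- If `τ² H_k < k / n`, the window sign vectors form a `τ`-hitting set. -/
lemma isHittingSet_windowSignVectors {n : ℕ} [NeZero n] {k : ℕ} (hk : k ≤ n) {τ : ℝ}
    (hτ₀ : 0 ≤ τ) (hτ : τ ^ 2 * (harmonic k : ℝ) < k / n) :
    IsHittingSet (windowSignVectors n k) τ := by
  refine ⟨?_, fun x hx => ?_⟩
  · rintro _ ⟨s, ⟨-, hs⟩, rfl⟩
    exact norm_smul_inv_norm (𝕜 := ℝ) (signVector_ne_zero hs)
  obtain ⟨a, ha⟩ := exists_div_le_sum_cyclicWindow hk x hx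
  obtain ⟨S, hSW, hSne, hS⟩ : ∃ S ⊆ cyclicWindow k a, S.Nonempty ∧
      τ * √(#S : ℝ) < ∑ i ∈ S, |x i| := by
    by_contra! hcon
    have := sum_sq_le_sq_mul_harmonic (fun i => x i) τ (cyclicWindow k a) hcon
    rw [card_cyclicWindow hk] at this
    linarith
  set s : Fin n → SignType := fun i => if i ∈ S then SignType.sign (x i) else 0 with hs
  have hinner : ⟪x, signVector s⟫ = ∑ i ∈ S, |x i| := by
    rw [PiLp.inner_apply, ← Finset.univ_inter S, ← Finset.sum_ite_mem]
    refine Finset.sum_congr rfl fun i _ => ?_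
    by_cases hi : i ∈ S <;> simp [signVector, hs, hi, sign_mul_self]
  have hnorm : ‖signVector s‖ ≤ √(#S : ℝ) := by
    rw [EuclideanSpace.norm_eq]
    refine Real.sqrt_le_sqrt ?_
    rw [← nsmul_one, ← Finset.sum_const, ← Finset.univ_inter S, ← Finset.sum_ite_mem]
    refine Finset.sum_le_sum fun i _ => ?_
    by_cases hi : i ∈ S
    · simp only [signVector, hs, hi, if_true]
      cases SignType.sign (x i) <;> simp
    · simp [signVector, hs, hi]
  have hpos : 0 < ∑ i ∈ S, |x i| := (by positivity : 0 ≤ τ * √(#S : ℝ)).trans_lt hS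
  have hs₀ : s ≠ 0 := by
    intro h
    rw [← hinner, h] at hpos
    simp [signVector, PiLp.inner_apply] at hpos
  have hvpos : 0 < ‖signVector s‖ := norm_pos_iff.mpr (signVector_ne_zero hs₀)
  refine ⟨_, ⟨s, ⟨?_, hs₀⟩, rfl⟩, ?_⟩
  · refine Finset.mem_biUnion.mpr ⟨a, Finset.mem_univ a, Fintype.mem_piFinset.mpr fun i => ?_⟩
    by_cases hi : i ∈ S
    · simp [hSW hi]
    · simp only [hs, hi, if_false]
      split_ifs <;> simp
  · change τ ≤ ⟪x, ‖signVector s‖⁻¹ • signVector s⟫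
    rw [real_inner_smul_right, hinner, ← div_eq_inv_mul, le_div_iff₀ hvpos]
    exact (mul_le_mul_of_nonneg_left hnorm hτ₀).trans hS.le

lemma three_pow_floor_log_le {n : ℕ} (hn : 1 ≤ n) :
    (3 : ℝ) ^ ⌊Real.log n⌋₊ ≤ (n : ℝ) ^ Real.log 3 := by
  have hn' : (1 : ℝ) ≤ n := by exact_mod_cast hn
  rw [← Real.rpow_natCast, Real.rpow_def_of_pos (by norm_num),
    Real.rpow_def_of_pos (by linarith), mul_comm (Real.log n)]
  gcongr
  exact Nat.floor_le (Real.log_nonneg hn')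

lemma one_lt_log_three : 1 < Real.log 3 := by
  rw [Real.lt_log_iff_exp_lt (by norm_num)]
  exact Real.exp_one_lt_three

/-- There exist constants `c > 0` and `C > 0` such that for every integer
`n ≥ 3` there exists a finite `τ`-hitting set `H ⊆ Sⁿ` with
`τ ≥ c·√(ln n/(n·ln ln n))` and `|H| ≤ C·n^{1 + ln 3}`. -/
theorem stmt9 :
    ∃ c C : ℝ, 0 < c ∧ 0 < C ∧
      ∀ n : ℕ, 3 ≤ n →
        ∃ (H : Set (EuclideanSpace ℝ (Fin n))) (τ : ℝ),
          H.Finite ∧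
          c * Real.sqrt (Real.log n / (n * Real.log (Real.log n))) ≤ τ ∧
          IsHittingSet H τ ∧
          (H.ncard : ℝ) ≤ C * (n : ℝ) ^ ((1 : ℝ) + Real.log 3) := by
  set t₀ := Real.log (Real.log 3)
  have ht₀pos : 0 < t₀ := Real.log_pos one_lt_log_three
  refine ⟨√(t₀ / (2 * (1 + t₀))), 1, by positivity, one_pos, fun n hn => ?_⟩
  have : NeZero n := ⟨by omega⟩
  have hn₃ : (3 : ℝ) ≤ n := by exact_mod_cast hn
  have hlog : Real.log 3 ≤ Real.log n := Real.log_le_log (by norm_num) hn₃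
  have hloglog : t₀ ≤ Real.log (Real.log n) :=
    Real.log_le_log (by linarith [one_lt_log_three]) hlog
  set L := Real.log n
  have hL₁ : 1 < L := one_lt_log_three.trans_le hlog
  set t := Real.log L
  have htpos : 0 < t := ht₀pos.trans_le hloglog
  have hkL : (⌊L⌋₊ : ℝ) ≤ L := Nat.floor_le (by linarith)
  have hk₁ : (1 : ℝ) ≤ ⌊L⌋₊ := by exact_mod_cast Nat.le_floor (by exact_mod_cast hL₁.le)
  have hk₂ : L / 2 < ⌊L⌋₊ := by linarith [Nat.lt_floor_add_one L]
  have hkn : ⌊L⌋₊ ≤ n := by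
    have : L ≤ n := Real.log_le_self (by linarith)
    exact_mod_cast hkL.trans this
  refine ⟨windowSignVectors n ⌊L⌋₊, _, finite_windowSignVectors _ _, le_rfl,
    isHittingSet_windowSignVectors hkn (by positivity) ?_, ?_⟩
  · rw [mul_pow, Real.sq_sqrt (by positivity), Real.sq_sqrt (by positivity)]
    have hharm : (harmonic ⌊L⌋₊ : ℝ) ≤ 1 + t :=
      (harmonic_le_one_add_log _).trans (by gcongr; exact Real.log_le_log (by linarith) hkL)
    have hratio : t₀ / (1 + t₀) * ((1 + t) / t) ≤ 1 := by
      rw [div_mul_div_comm, div_le_one (by positivity)]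
      nlinarith
    calc t₀ / (2 * (1 + t₀)) * (L / (n * t)) * (harmonic ⌊L⌋₊ : ℝ)
        ≤ t₀ / (2 * (1 + t₀)) * (L / (n * t)) * (1 + t) := by gcongr
      _ = t₀ / (1 + t₀) * ((1 + t) / t) * (L / 2 / n) := by field_simp
      _ ≤ 1 * (L / 2 / n) := by gcongr
      _ < ⌊L⌋₊ / n := by rw [one_mul]; gcongr
  · rw [one_mul, Real.rpow_add (by linarith), Real.rpow_one]
    calc ((windowSignVectors n ⌊L⌋₊).ncard : ℝ)
        ≤ n * 3 ^ ⌊L⌋₊ := by exact_mod_cast ncard_windowSignVectors_le hkn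
      _ ≤ n * (n : ℝ) ^ Real.log 3 := by
        gcongr
        exact three_pow_floor_log_le (by omega)
end

section
/- There exists a constant C > 0 such that for every integer n ≥ 2 there exists a finite 0.3·√(ln n/n)-hitting set H ⊆ Sⁿ with |H| ≤ C·n³. -/
open scoped RealInnerProductSpace

/-- The unit sphere of a finite-dimensional inner product space has a net of exponential size
at angle `π / 3`, given by a maximal `1`-separated set. -/
theorem exists_unit_net (E : Type*) [NormedAddCommGroup E] [InnerProductSpace ℝ E]
    [FiniteDimensional ℝ E] :
    ∃ N : Finset E, N.card ≤ 5 ^ Module.finrank ℝ E ∧ (∀ v ∈ N, ‖v‖ = 1) ∧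
      ∀ y : E, y ≠ 0 → ∃ v ∈ N, ‖y‖ / 2 ≤ ⟪y, v⟫ := by
  classical
  let P : Finset E → Prop := fun s =>
    (∀ c ∈ s, ‖c‖ = 1) ∧ ∀ c ∈ s, ∀ d ∈ s, c ≠ d → 1 ≤ ‖c - d‖
  have hP : ∀ s, P s → s.card ≤ 5 ^ Module.finrank ℝ E := fun s hs =>
    Besicovitch.card_le_of_separated s (fun c hc => by rw [hs.1 c hc]; norm_num) hs.2
  obtain ⟨N, hN, hmax⟩ : ∃ N, P N ∧ ∀ s, P s → s.card ≤ N.card := by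
    have hfin : ({m | ∃ s, P s ∧ s.card = m} : Set ℕ).Finite :=
      (Set.finite_Iic (5 ^ Module.finrank ℝ E)).subset fun m ⟨s, hs, hm⟩ => hm ▸ hP s hs
    obtain ⟨m, ⟨N, hN, rfl⟩, hm⟩ :=
      Set.exists_max_image _ id hfin ⟨0, ∅, by simp [P], rfl⟩
    exact ⟨N, hN, fun s hs => hm _ ⟨s, hs, rfl⟩⟩
  refine ⟨N, hP N hN, hN.1, fun y hy => ?_⟩
  have hy0 : 0 < ‖y‖ := norm_pos_iff.mpr hy
  set u : E := ‖y‖⁻¹ • y with hu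
  have hu1 : ‖u‖ = 1 := norm_smul_inv_norm (𝕜 := ℝ) hy
  have hclose : ∃ v ∈ N, ‖u - v‖ ≤ 1 := by
    by_contra! hfar
    have huN : u ∉ N := fun h => by simpa using (hfar u h).trans' one_pos
    have hins : P (insert u N) := by
      refine ⟨fun c hc => ?_, fun c hc d hd hcd => ?_⟩
      · rcases Finset.mem_insert.mp hc with rfl | hc
        exacts [hu1, hN.1 c hc]
      · rcases Finset.mem_insert.mp hc with rfl | hc <;>
          rcases Finset.mem_insert.mp hd with rfl | hd
        · exact absurd rfl hcd
        · exact (hfar d hd).le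
        · rw [norm_sub_rev]; exact (hfar c hc).le
        · exact hN.2 c hc d hd hcd
    have := hmax _ hins
    rw [Finset.card_insert_of_notMem huN] at this
    omega
  obtain ⟨v, hv, hvu⟩ := hclose
  refine ⟨v, hv, ?_⟩
  have hhalf : 1 / 2 ≤ ⟪u, v⟫ := by
    have h := norm_sub_sq_real u v
    rw [hu1, hN.1 v hv] at h
    nlinarith [norm_nonneg (u - v)]
  have hyu : y = ‖y‖ • u := by rw [hu, smul_inv_smul₀ hy0.ne']
  have hinner : ⟪y, v⟫ = ‖y‖ * ⟪u, v⟫ := by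
    conv_lhs => rw [hyu]
    exact real_inner_smul_left _ _ _
  rw [hinner]
  nlinarith

/-- The coordinate subspace of vectors supported on `B`. -/
def coordinateSubspace {n : ℕ} (B : Finset (Fin n)) :
    Submodule ℝ (EuclideanSpace ℝ (Fin n)) where
  carrier := {w | ∀ j ∉ B, w j = 0}
  add_mem' ha hb j hj := by simp [ha j hj, hb j hj]
  zero_mem' j _ := rfl
  smul_mem' c w hw j hj := by simp [hw j hj]

theorem finrank_coordinateSubspace_le {n : ℕ} (B : Finset (Fin n)) :
    Module.finrank ℝ (coordinateSubspace B) ≤ B.card := by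
  let f : coordinateSubspace B →ₗ[ℝ] (B → ℝ) :=
    { toFun := fun w j => w.1 j
      map_add' := fun _ _ => rfl
      map_smul' := fun _ _ => rfl }
  have hf : Function.Injective f := fun a b hab => by
    ext j
    by_cases hj : j ∈ B
    · exact congrFun hab ⟨j, hj⟩
    · rw [a.2 j hj, b.2 j hj]
  simpa using LinearMap.finrank_le_finrank_of_injective hf

/-- Unit vectors supported on `B` that detect the mass which a vector carries on `B`. -/
theorem exists_block_net {n : ℕ} (B : Finset (Fin n)) :
    ∃ N : Finset (EuclideanSpace ℝ (Fin n)), N.card ≤ 5 ^ B.card ∧ (∀ v ∈ N, ‖v‖ = 1) ∧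
      ∀ x : EuclideanSpace ℝ (Fin n), 0 < ∑ j ∈ B, x j ^ 2 →
        ∃ v ∈ N, √(∑ j ∈ B, x j ^ 2) / 2 ≤ ⟪x, v⟫ := by
  classical
  obtain ⟨N, hcard, hunit, hnet⟩ := exists_unit_net (coordinateSubspace B)
  refine ⟨N.map (Function.Embedding.subtype _), ?_, ?_, fun x hx => ?_⟩
  · rw [Finset.card_map]
    exact hcard.trans (Nat.pow_le_pow_right (by norm_num) (finrank_coordinateSubspace_le B))
  · simpa using fun v hv hvN => hunit ⟨v, hv⟩ hvN
  · let y : coordinateSubspace B :=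
      ⟨WithLp.toLp 2 fun j => if j ∈ B then x j else 0, fun j hj => by simp [hj]⟩
    have hnorm : ‖y‖ = √(∑ j ∈ B, x j ^ 2) := by
      rw [Submodule.coe_norm, EuclideanSpace.norm_eq]
      congr 1
      simp [y, ite_pow, Finset.sum_ite_mem]
    have hy : y ≠ 0 := by
      rw [← norm_pos_iff, hnorm]
      exact Real.sqrt_pos.mpr hx
    obtain ⟨v, hv, hyv⟩ := hnet y hy
    refine ⟨v, by simpa using hv, ?_⟩
    rw [← hnorm]
    refine hyv.trans_eq ?_
    rw [Submodule.coe_inner, PiLp.inner_apply, PiLp.inner_apply]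
    refine Finset.sum_congr rfl fun j _ => ?_
    by_cases hj : j ∈ B
    · simp [y, hj]
    · simp [y, hj, v.2 j hj]

/-- Some cyclic translate of `T` carries at least the average mass of a unit vector. -/
theorem exists_translate_mass {n : ℕ} [NeZero n] (T : Finset (Fin n))
    (x : EuclideanSpace ℝ (Fin n)) (hx : ‖x‖ = 1) :
    ∃ i : Fin n, (T.card : ℝ) / n ≤ ∑ j ∈ T.map (Equiv.addLeft i).toEmbedding, x j ^ 2 := by
  have hsq : ∑ j, x j ^ 2 = 1 := by
    rw [← EuclideanSpace.real_norm_sq_eq, hx, one_pow]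
  have htotal : ∑ i : Fin n, ∑ j ∈ T.map (Equiv.addLeft i).toEmbedding, x j ^ 2 = T.card := by
    simp only [Finset.sum_map, Equiv.coe_toEmbedding, Equiv.coe_addLeft]
    rw [Finset.sum_comm]
    have hshift (j : Fin n) : ∑ i : Fin n, x (i + j) ^ 2 = 1 := by
      rw [← hsq]
      exact Equiv.sum_comp (Equiv.addRight j) fun i => x i ^ 2
    simp [hshift]
  obtain ⟨i, -, hi⟩ := Finset.exists_le_of_sum_le (s := Finset.univ)
    (f := fun _ : Fin n => (T.card : ℝ) / n)
    (g := fun i => ∑ j ∈ T.map (Equiv.addLeft i).toEmbedding, x j ^ 2)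
    Finset.univ_nonempty (by
      rw [htotal, Finset.sum_const, Finset.card_univ, Fintype.card_fin, nsmul_eq_mul,
        mul_div_cancel₀ _ (Nat.cast_ne_zero.mpr (NeZero.ne n))])
  exact ⟨i, hi⟩

theorem exists_isHittingSet_of_block_size {n k : ℕ} (hk : 0 < k) (hkn : k ≤ n) :
    ∃ H : Set (EuclideanSpace ℝ (Fin n)),
      H.Finite ∧ IsHittingSet H (√((k : ℝ) / n) / 2) ∧ H.ncard ≤ n * 5 ^ k := by
  classical
  have : NeZero n := ⟨by omega⟩
  obtain ⟨T, -, hT⟩ := Finset.exists_subset_card_eq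
    (s := (Finset.univ : Finset (Fin n))) (n := k) (by simpa using hkn)
  choose N hcard hunit hnet using fun i : Fin n =>
    exists_block_net (T.map (Equiv.addLeft i).toEmbedding)
  refine ⟨(Finset.univ.biUnion N : Finset _), Finset.finite_toSet _, ⟨?_, fun x hx => ?_⟩, ?_⟩
  · simpa using fun v i hv => hunit i v hv
  · obtain ⟨i, hi⟩ := exists_translate_mass T x hx
    rw [hT] at hi
    have hpos : (0 : ℝ) < k / n := by
      have : 0 < n := by omega
      positivity
    obtain ⟨v, hv, hxv⟩ := hnet i x (hpos.trans_le hi)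
    refine ⟨v, by simpa using ⟨i, hv⟩, le_trans ?_ hxv⟩
    gcongr
  · rw [Set.ncard_coe_finset]
    refine (Finset.card_biUnion_le_card_mul _ _ (5 ^ k) fun i _ => ?_).trans_eq (by simp)
    simpa [hT] using hcard i

theorem five_pow_ceil_log_le {n : ℕ} (hn : 1 ≤ n) :
    (5 : ℝ) ^ ⌈0.36 * Real.log n⌉₊ ≤ 5 * n := by
  have hn0 : (0 : ℝ) < n := by exact_mod_cast hn
  have hlog : 0 ≤ Real.log n := Real.log_natCast_nonneg n
  have hlog5 : Real.log 5 ≤ 2 := by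
    rw [Real.log_le_iff_le_exp (by norm_num)]
    have h := Real.exp_one_gt_d9
    have h2 : Real.exp 2 = Real.exp 1 * Real.exp 1 := by rw [← Real.exp_add]; norm_num
    nlinarith
  have hlog5' : 0 ≤ Real.log 5 := Real.log_nonneg (by norm_num)
  have hceil : (⌈0.36 * Real.log n⌉₊ : ℝ) ≤ 0.36 * Real.log n + 1 :=
    (Nat.ceil_lt_add_one (by positivity)).le
  rw [← Real.log_le_log_iff (by positivity) (by positivity), Real.log_pow,
    Real.log_mul (by norm_num) hn0.ne']
  nlinarith [mul_le_mul_of_nonneg_right hceil hlog5', mul_le_mul_of_nonneg_left hlog5 hlog]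

/-- There exists a constant `C > 0` such that for every integer `n ≥ 2`
there exists a finite `0.3·√(ln n/n)`-hitting set `H ⊆ Sⁿ` with `|H| ≤ C·n³`. -/
theorem stmt11 :
    ∃ C : ℝ, 0 < C ∧
      ∀ n : ℕ, 2 ≤ n →
        ∃ H : Set (EuclideanSpace ℝ (Fin n)),
          H.Finite ∧
          IsHittingSet H (0.3 * Real.sqrt (Real.log n / n)) ∧
          (H.ncard : ℝ) ≤ C * (n : ℝ) ^ 3 := by
  refine ⟨5, by norm_num, fun n hn => ?_⟩
  have hn2 : (2 : ℝ) ≤ n := by exact_mod_cast hn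
  have hlog : 0 < Real.log n := Real.log_pos (by linarith)
  set k : ℕ := ⌈0.36 * Real.log n⌉₊ with hk
  have hk0 : 0 < k := Nat.ceil_pos.mpr (by positivity)
  have hkn : k ≤ n := Nat.ceil_le.mpr (by
    linarith [Real.log_le_sub_one_of_pos (show (0 : ℝ) < n by linarith)])
  obtain ⟨H, hfin, ⟨hunit, hhit⟩, hcard⟩ := exists_isHittingSet_of_block_size hk0 hkn
  refine ⟨H, hfin, ⟨hunit, fun x hx => ?_⟩, ?_⟩
  · obtain ⟨v, hv, hxv⟩ := hhit x hx
    refine ⟨v, hv, le_trans ?_ hxv⟩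
    have hscale : 0.6 * √(Real.log n / n) = √(0.36 * Real.log n / n) := by
      rw [mul_div_assoc, Real.sqrt_mul (by norm_num),
        show (0.36 : ℝ) = 0.6 ^ 2 by norm_num, Real.sqrt_sq (by norm_num)]
    have hle : √(0.36 * Real.log n / n) ≤ √((k : ℝ) / n) := by
      gcongr
      exact Nat.le_ceil _
    linarith
  · have hcard' : (H.ncard : ℝ) ≤ n * 5 ^ k := by exact_mod_cast hcard
    calc (H.ncard : ℝ) ≤ n * 5 ^ k := hcard'
      _ ≤ n * (5 * n) := by gcongr; exact five_pow_ceil_log_le (by omega)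
      _ = 5 * (n : ℝ) ^ 2 := by ring
      _ ≤ 5 * (n : ℝ) ^ 3 := by gcongr <;> linarith
end

section
/- Let d ≥ 3 and n₁, …, n_d ≥ 1 be integers, and let T = (t_{i₁…i_d}) be an order-d tensor in ℝ^{n₁×⋯×n_d}. For k = 1, …, d−2 let τ_k ∈ [0, 1] and let H_k ⊆ S^{n_k} be a τ_k-hitting set. Then there exist z_k ∈ H_k for k = 1, …, d−2 and unit vectors y_{d−1} ∈ S^{n_{d−1}}, y_d ∈ S^{n_d} such that T(z₁, …, z_{d−2}, y_{d−1}, y_d) ≥ (Π_{k=1}^{d−2} τ_k) · ‖T‖_σ. -/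
open scoped RealInnerProductSpace

/-- The multilinear form `T(x₁,…,x_d) = Σ_{i₁,…,i_d} t_{i₁…i_d} (x₁)_{i₁}⋯(x_d)_{i_d}`
associated with an order-`d` tensor `T ∈ ℝ^{n₁×⋯×n_d}`. -/
noncomputable def tmulD {d : ℕ} {n : Fin d → ℕ} (T : (∀ k, Fin (n k)) → ℝ)
    (x : ∀ k, EuclideanSpace ℝ (Fin (n k))) : ℝ :=
  ∑ i : ∀ k, Fin (n k), T i * ∏ k, x k (i k)

/-- The spectral norm `‖T‖_σ = max{T(x₁,…,x_d) : ‖x_k‖ = 1 for all k}` of an order-`d`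
tensor. -/
noncomputable def spectralNormD {d : ℕ} {n : Fin d → ℕ} (T : (∀ k, Fin (n k)) → ℝ) : ℝ :=
  sSup {r : ℝ | ∃ x : ∀ k, EuclideanSpace ℝ (Fin (n k)),
    (∀ k, ‖x k‖ = 1) ∧ r = tmulD T x}

/-- The form of a tensor is linear in each argument, hence given in its `a`-th argument by the
inner product with some vector. -/
theorem exists_inner_eq_tmulD_update {d : ℕ} {n : Fin d → ℕ} (T : (∀ k, Fin (n k)) → ℝ)
    (x : ∀ k, EuclideanSpace ℝ (Fin (n k))) (a : Fin d) :
    ∃ g : EuclideanSpace ℝ (Fin (n a)), ∀ v, tmulD T (Function.update x a v) = ⟪g, v⟫ := by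
  have hprod : ∀ (v : EuclideanSpace ℝ (Fin (n a))) (i : ∀ k, Fin (n k)),
      ∏ k, (Function.update x a v) k (i k) = v (i a) * ∏ k ∈ Finset.univ.erase a, x k (i k) := by
    intro v i
    rw [← Finset.mul_prod_erase _ _ (Finset.mem_univ a), Function.update_self]
    congr 1
    refine Finset.prod_congr rfl fun k hk => ?_
    rw [Function.update_of_ne (Finset.ne_of_mem_erase hk)]
  let φ : EuclideanSpace ℝ (Fin (n a)) →ₗ[ℝ] ℝ :=
    { toFun := fun v => tmulD T (Function.update x a v)
      map_add' := fun v w => by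
        simp only [tmulD, hprod, PiLp.add_apply, ← Finset.sum_add_distrib]
        exact Finset.sum_congr rfl fun i _ => by ring
      map_smul' := fun c v => by
        simp only [tmulD, hprod, PiLp.smul_apply, smul_eq_mul, RingHom.id_apply, Finset.mul_sum]
        exact Finset.sum_congr rfl fun i _ => by ring }
  refine ⟨(InnerProductSpace.toDual ℝ _).symm (LinearMap.toContinuousLinearMap φ), fun v => ?_⟩
  rw [InnerProductSpace.toDual_symm_apply]
  rfl

/-- A linear functional `⟪g, ·⟫` is at least `τ ‖g‖` at some point of a `τ`-hitting set. -/
theorem IsHittingSet.exists_mul_norm_le_inner {n : ℕ} {H : Set (EuclideanSpace ℝ (Fin n))} {τ : ℝ}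
    (hH : IsHittingSet H τ) (hn : 1 ≤ n) (g : EuclideanSpace ℝ (Fin n)) :
    ∃ v ∈ H, τ * ‖g‖ ≤ ⟪g, v⟫ := by
  by_cases hg : g = 0
  · obtain ⟨v, hv, -⟩ := hH.2 (EuclideanSpace.single ⟨0, hn⟩ 1) (by simp)
    exact ⟨v, hv, by simp [hg]⟩
  · have hpos : 0 < ‖g‖ := norm_pos_iff.mpr hg
    obtain ⟨v, hv, h⟩ := hH.2 (‖g‖⁻¹ • g) (norm_smul_inv_norm hg)
    refine ⟨v, hv, ?_⟩
    rwa [real_inner_smul_left, inv_mul_eq_div, le_div_iff₀ hpos] at h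

/-- The spectral norm of a tensor is attained. -/
theorem exists_tmulD_eq_spectralNormD {d : ℕ} {n : Fin d → ℕ} (hn : ∀ k, 1 ≤ n k)
    (T : (∀ k, Fin (n k)) → ℝ) :
    ∃ x : ∀ k, EuclideanSpace ℝ (Fin (n k)), (∀ k, ‖x k‖ = 1) ∧ spectralNormD T = tmulD T x := by
  have hcont : Continuous fun x : ∀ k, EuclideanSpace ℝ (Fin (n k)) => tmulD T x := by
    unfold tmulD
    fun_prop
  have hcomp : IsCompact (Set.univ.pi fun k : Fin d =>
      Metric.sphere (0 : EuclideanSpace ℝ (Fin (n k))) 1) :=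
    isCompact_univ_pi fun k => isCompact_sphere _ _
  obtain ⟨x, hx, hmax⟩ := hcomp.exists_isMaxOn
    ⟨fun k => EuclideanSpace.single ⟨0, hn k⟩ 1, by simp [Set.mem_pi]⟩ hcont.continuousOn
  have hx' : ∀ k, ‖x k‖ = 1 := by simpa [Set.mem_pi] using hx
  refine ⟨x, hx', IsGreatest.csSup_eq ⟨⟨x, hx', rfl⟩, ?_⟩⟩
  rintro r ⟨y, hy, rfl⟩
  exact hmax (by simpa [Set.mem_pi] using hy)

/-- The arguments with index in a finite set `s` can be moved into hitting sets at the cost of the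
factor `∏ k ∈ s, τ k`. -/
theorem exists_mem_prod_mul_spectralNormD_le {d : ℕ} {n : Fin d → ℕ} (hn : ∀ k, 1 ≤ n k)
    (T : (∀ k, Fin (n k)) → ℝ) (τ : Fin d → ℝ) (H : ∀ k, Set (EuclideanSpace ℝ (Fin (n k))))
    (s : Finset (Fin d)) (hτ : ∀ k ∈ s, 0 ≤ τ k) (hH : ∀ k ∈ s, IsHittingSet (H k) (τ k)) :
    ∃ x : ∀ k, EuclideanSpace ℝ (Fin (n k)),
      (∀ k ∈ s, x k ∈ H k) ∧ (∀ k, ‖x k‖ = 1) ∧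
      (∏ k ∈ s, τ k) * spectralNormD T ≤ tmulD T x := by
  induction s using Finset.induction_on with
  | empty =>
    obtain ⟨x, hx, h⟩ := exists_tmulD_eq_spectralNormD hn T
    exact ⟨x, by simp, hx, by simp [h]⟩
  | insert a s ha ih =>
    obtain ⟨x, hxH, hx, hle⟩ := ih (fun k hk => hτ k (Finset.mem_insert_of_mem hk))
      fun k hk => hH k (Finset.mem_insert_of_mem hk)
    have hHa := hH a (Finset.mem_insert_self a s)
    obtain ⟨g, hg⟩ := exists_inner_eq_tmulD_update T x a
    obtain ⟨v, hv, hgv⟩ := hHa.exists_mul_norm_le_inner (hn a) g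
    refine ⟨Function.update x a v, fun k hk => ?_, fun k => ?_, ?_⟩
    · rcases eq_or_ne k a with rfl | hka
      · simpa using hv
      · rw [Function.update_of_ne hka]
        exact hxH k (Finset.mem_of_mem_insert_of_ne hk hka)
    · rcases eq_or_ne k a with rfl | hka
      · simpa using hHa.1 v hv
      · rw [Function.update_of_ne hka]
        exact hx k
    · have hTx : tmulD T x ≤ ‖g‖ := by
        have h := real_inner_le_norm g (x a)
        rwa [← hg, Function.update_eq_self, hx a, mul_one] at h
      rw [Finset.prod_insert ha, mul_assoc, hg]
      exact (mul_le_mul_of_nonneg_left (hle.trans hTx) (hτ a (Finset.mem_insert_self a s))).trans hgv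

/-- Let `d ≥ 3` and let `T ∈ ℝ^{n₁×⋯×n_d}`. If for each `k = 1,…,d−2` the
set `H_k ⊆ S^{n_k}` is a `τ_k`-hitting set (`τ_k ∈ [0,1]`), then there exist `z_k ∈ H_k`
for `k = 1,…,d−2` and unit vectors in the last two coordinates such that
`T(z₁,…,z_{d−2},y_{d−1},y_d) ≥ (Π_{k=1}^{d−2} τ_k)·‖T‖_σ`. -/
theorem stmt13 (d : ℕ) (hd : 3 ≤ d) (n : Fin d → ℕ) (hn : ∀ k, 1 ≤ n k)
    (T : (∀ k, Fin (n k)) → ℝ) (τ : Fin d → ℝ)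
    (hτ : ∀ k : Fin d, (k : ℕ) < d - 2 → 0 ≤ τ k ∧ τ k ≤ 1)
    (H : ∀ k, Set (EuclideanSpace ℝ (Fin (n k))))
    (hH : ∀ k : Fin d, (k : ℕ) < d - 2 → IsHittingSet (H k) (τ k)) :
    ∃ x : ∀ k, EuclideanSpace ℝ (Fin (n k)),
      (∀ k : Fin d, (k : ℕ) < d - 2 → x k ∈ H k) ∧ (∀ k, ‖x k‖ = 1) ∧
      (∏ k ∈ Finset.univ.filter fun k : Fin d => (k : ℕ) < d - 2, τ k) * spectralNormD T ≤
        tmulD T x := by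
  simpa using exists_mem_prod_mul_spectralNormD_le hn T τ H
    (Finset.univ.filter fun k : Fin d => (k : ℕ) < d - 2)
    (fun k hk => (hτ k (by simpa using hk)).1) fun k hk => hH k (by simpa using hk)
end

section
/- Let n₁, n₂, n₃ ≥ 1 be integers, T ∈ ℝ^{n₁×n₂×n₃}, τ ∈ (0, 1], and let H ⊆ S^{n₁} be a finite τ-hitting set. Define u = sup{⟨T, Z⟩ : Z ∈ ℝ^{n₁×n₂×n₃} such that for every x ∈ H and all unit y ∈ S^{n₂}, w ∈ S^{n₃}, Z(x, y, w) ≤ 1}. Then ‖T‖_* ≤ u ≤ ‖T‖_*/τ; equivalently, τ·u ≤ ‖T‖_* ≤ u, so u approximates the nuclear norm of T with approximation bound τ. -/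
open scoped RealInnerProductSpace

/-- The trilinear form `Z(x,y,z) = Σ_{i,j,k} z_{ijk} x_i y_j z_k` associated with a
third-order tensor `Z ∈ ℝ^{n₁×n₂×n₃}`. -/
noncomputable def tmul {n₁ n₂ n₃ : ℕ} (T : Fin n₁ → Fin n₂ → Fin n₃ → ℝ)
    (x : EuclideanSpace ℝ (Fin n₁)) (y : EuclideanSpace ℝ (Fin n₂))
    (z : EuclideanSpace ℝ (Fin n₃)) : ℝ :=
  ∑ i, ∑ j, ∑ k, T i j k * x i * y j * z k

/-- The nuclear norm
`‖T‖_* = inf{Σ|λ_i| : T = Σ λ_i x_i ⊗ y_i ⊗ z_i, ‖x_i‖ = ‖y_i‖ = ‖z_i‖ = 1}` of a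
third-order tensor. -/
noncomputable def nuclearNorm {n₁ n₂ n₃ : ℕ} (T : Fin n₁ → Fin n₂ → Fin n₃ → ℝ) : ℝ :=
  sInf {s : ℝ | ∃ (r : ℕ) (lam : Fin r → ℝ)
      (x : Fin r → EuclideanSpace ℝ (Fin n₁)) (y : Fin r → EuclideanSpace ℝ (Fin n₂))
      (z : Fin r → EuclideanSpace ℝ (Fin n₃)),
      (∀ l, ‖x l‖ = 1 ∧ ‖y l‖ = 1 ∧ ‖z l‖ = 1) ∧
      (∀ i j k, T i j k = ∑ l, lam l * x l i * y l j * z l k) ∧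
      s = ∑ l, |lam l|}

/-- The Frobenius inner product `⟨T, Z⟩ = Σ_{i,j,k} t_{ijk} z_{ijk}`. -/
noncomputable def frob {n₁ n₂ n₃ : ℕ} (T Z : Fin n₁ → Fin n₂ → Fin n₃ → ℝ) : ℝ :=
  ∑ i, ∑ j, ∑ k, T i j k * Z i j k

section NuclearNorm

variable {n₁ n₂ n₃ : ℕ}

/-- `s` is the total weight of some finite decomposition of `T` into unit rank-one tensors. -/
def IsDecompositionCost (T : Fin n₁ → Fin n₂ → Fin n₃ → ℝ) (s : ℝ) : Prop :=
  ∃ (r : ℕ) (lam : Fin r → ℝ)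
    (x : Fin r → EuclideanSpace ℝ (Fin n₁)) (y : Fin r → EuclideanSpace ℝ (Fin n₂))
    (z : Fin r → EuclideanSpace ℝ (Fin n₃)),
    (∀ l, ‖x l‖ = 1 ∧ ‖y l‖ = 1 ∧ ‖z l‖ = 1) ∧
    (∀ i j k, T i j k = ∑ l, lam l * x l i * y l j * z l k) ∧
    s = ∑ l, |lam l|

lemma IsDecompositionCost.nonneg {T : Fin n₁ → Fin n₂ → Fin n₃ → ℝ} {s : ℝ}
    (h : IsDecompositionCost T s) : 0 ≤ s := by
  obtain ⟨r, lam, x, y, z, -, -, rfl⟩ := h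
  exact Finset.sum_nonneg fun _ _ => abs_nonneg _

/-- Decompositions may be indexed by any finite type. -/
lemma IsDecompositionCost.of_fintype {ι : Type*} [Fintype ι]
    {T : Fin n₁ → Fin n₂ → Fin n₃ → ℝ} (lam : ι → ℝ)
    (x : ι → EuclideanSpace ℝ (Fin n₁)) (y : ι → EuclideanSpace ℝ (Fin n₂))
    (z : ι → EuclideanSpace ℝ (Fin n₃))
    (hu : ∀ l, ‖x l‖ = 1 ∧ ‖y l‖ = 1 ∧ ‖z l‖ = 1)
    (hT : ∀ i j k, T i j k = ∑ l, lam l * x l i * y l j * z l k) :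
    IsDecompositionCost T (∑ l, |lam l|) := by
  let e := (Fintype.equivFin ι).symm
  refine ⟨_, lam ∘ e, x ∘ e, y ∘ e, z ∘ e, fun l => hu _, fun i j k => ?_, ?_⟩
  · rw [hT]
    exact (e.sum_comp fun l => lam l * x l i * y l j * z l k).symm
  · exact (e.sum_comp fun l => |lam l|).symm

lemma exists_isDecompositionCost (T : Fin n₁ → Fin n₂ → Fin n₃ → ℝ) :
    ∃ s, IsDecompositionCost T s := by
  refine ⟨_, IsDecompositionCost.of_fintype (ι := Fin n₁ × Fin n₂ × Fin n₃)
    (fun p => T p.1 p.2.1 p.2.2) (fun p => EuclideanSpace.single p.1 1)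
    (fun p => EuclideanSpace.single p.2.1 1) (fun p => EuclideanSpace.single p.2.2 1)
    (fun p => by simp) fun i j k => ?_⟩
  simp [Fintype.sum_prod_type]

lemma nuclearNorm_le {T : Fin n₁ → Fin n₂ → Fin n₃ → ℝ} {s : ℝ}
    (h : IsDecompositionCost T s) : nuclearNorm T ≤ s :=
  csInf_le ⟨0, fun _ hs => IsDecompositionCost.nonneg hs⟩ h

lemma le_nuclearNorm {T : Fin n₁ → Fin n₂ → Fin n₃ → ℝ} {a : ℝ}
    (h : ∀ s, IsDecompositionCost T s → a ≤ s) : a ≤ nuclearNorm T :=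
  le_csInf (exists_isDecompositionCost T) h

lemma nuclearNorm_nonneg (T : Fin n₁ → Fin n₂ → Fin n₃ → ℝ) : 0 ≤ nuclearNorm T :=
  le_nuclearNorm fun _ hs => hs.nonneg

lemma nuclearNorm_zero : nuclearNorm (0 : Fin n₁ → Fin n₂ → Fin n₃ → ℝ) = 0 := by
  refine le_antisymm (nuclearNorm_le ?_) (nuclearNorm_nonneg _)
  simpa using IsDecompositionCost.of_fintype (ι := Empty)
    (T := (0 : Fin n₁ → Fin n₂ → Fin n₃ → ℝ)) (fun _ => 0)
    (fun l => l.elim) (fun l => l.elim) (fun l => l.elim) (fun l => l.elim) (by simp)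

lemma IsDecompositionCost.add {S T : Fin n₁ → Fin n₂ → Fin n₃ → ℝ} {s t : ℝ}
    (hs : IsDecompositionCost S s) (ht : IsDecompositionCost T t) :
    IsDecompositionCost (S + T) (s + t) := by
  obtain ⟨r, lam, x, y, z, hu, hS, rfl⟩ := hs
  obtain ⟨r', lam', x', y', z', hu', hT, rfl⟩ := ht
  have key := IsDecompositionCost.of_fintype (ι := Fin r ⊕ Fin r') (T := S + T)
    (Sum.elim lam lam') (Sum.elim x x') (Sum.elim y y') (Sum.elim z z')
    (by rintro (l | l); exacts [hu l, hu' l])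
    (fun i j k => by simp [hS, hT])
  simpa using key

lemma IsDecompositionCost.smul {T : Fin n₁ → Fin n₂ → Fin n₃ → ℝ} {s c : ℝ} (hc : 0 ≤ c)
    (hs : IsDecompositionCost T s) : IsDecompositionCost (c • T) (c * s) := by
  obtain ⟨r, lam, x, y, z, hu, hT, rfl⟩ := hs
  refine ⟨r, fun l => c * lam l, x, y, z, hu, fun i j k => ?_, ?_⟩
  · simp [hT, Finset.mul_sum, mul_assoc]
  · simp [abs_mul, abs_of_nonneg hc, Finset.mul_sum]

lemma nuclearNorm_add_le (S T : Fin n₁ → Fin n₂ → Fin n₃ → ℝ) :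
    nuclearNorm (S + T) ≤ nuclearNorm S + nuclearNorm T := by
  rw [← sub_le_iff_le_add]
  refine le_nuclearNorm fun s hs => ?_
  rw [sub_le_comm]
  refine le_nuclearNorm fun t ht => ?_
  linarith [nuclearNorm_le (hs.add ht)]

lemma nuclearNorm_smul {c : ℝ} (hc : 0 < c) (T : Fin n₁ → Fin n₂ → Fin n₃ → ℝ) :
    nuclearNorm (c • T) = c * nuclearNorm T := by
  have key : ∀ {c : ℝ}, 0 < c → ∀ T : Fin n₁ → Fin n₂ → Fin n₃ → ℝ,
      nuclearNorm (c • T) ≤ c * nuclearNorm T := by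
    intro c hc T
    rw [← div_le_iff₀' hc]
    refine le_nuclearNorm fun s hs => ?_
    rw [div_le_iff₀' hc]
    exact nuclearNorm_le (hs.smul hc.le)
  refine le_antisymm (key hc T) ?_
  have h := key (inv_pos.2 hc) (c • T)
  rwa [inv_smul_smul₀ hc.ne', le_inv_mul_iff₀ hc] at h

/-- The rank-one tensor `x ⊗ y ⊗ z`. -/
def rankOneTensor (x : EuclideanSpace ℝ (Fin n₁)) (y : EuclideanSpace ℝ (Fin n₂))
    (z : EuclideanSpace ℝ (Fin n₃)) : Fin n₁ → Fin n₂ → Fin n₃ → ℝ :=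
  fun i j k => x i * y j * z k

lemma nuclearNorm_rankOneTensor_le {x : EuclideanSpace ℝ (Fin n₁)}
    {y : EuclideanSpace ℝ (Fin n₂)} {z : EuclideanSpace ℝ (Fin n₃)}
    (hx : ‖x‖ = 1) (hy : ‖y‖ = 1) (hz : ‖z‖ = 1) :
    nuclearNorm (rankOneTensor x y z) ≤ 1 := by
  refine nuclearNorm_le ?_
  simpa using IsDecompositionCost.of_fintype (ι := Unit) (T := rankOneTensor x y z)
    (fun _ => 1) (fun _ => x) (fun _ => y) (fun _ => z) (fun _ => ⟨hx, hy, hz⟩)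
    (by simp [rankOneTensor])

lemma frob_rankOneTensor (x : EuclideanSpace ℝ (Fin n₁)) (y : EuclideanSpace ℝ (Fin n₂))
    (z : EuclideanSpace ℝ (Fin n₃)) (Z : Fin n₁ → Fin n₂ → Fin n₃ → ℝ) :
    frob (rankOneTensor x y z) Z = tmul Z x y z := by
  simp only [frob, tmul, rankOneTensor]
  refine Finset.sum_congr rfl fun i _ => Finset.sum_congr rfl fun j _ =>
    Finset.sum_congr rfl fun k _ => by ring

/-- Every linear functional on tensors is a Frobenius inner product. -/
lemma exists_frob_eq (g : (Fin n₁ → Fin n₂ → Fin n₃ → ℝ) →ₗ[ℝ] ℝ) :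
    ∃ Z, ∀ T, g T = frob T Z := by
  refine ⟨fun i j k => g (Pi.single i (Pi.single j (Pi.single k 1))), fun T => ?_⟩
  have hT : T = ∑ i, ∑ j, ∑ k,
      T i j k • (Pi.single i (Pi.single j (Pi.single k 1)) :
        Fin n₁ → Fin n₂ → Fin n₃ → ℝ) := by
    funext a b c
    have hval (i : Fin n₁) (j : Fin n₂) (k : Fin n₃) :
        (Pi.single i (Pi.single j (Pi.single k 1)) : Fin n₁ → Fin n₂ → Fin n₃ → ℝ) a b c =
          if a = i then if b = j then if c = k then 1 else 0 else 0 else 0 := by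
      rw [Pi.single_apply]
      split_ifs <;> simp_all
    simp [Finset.sum_apply, hval]
  conv_lhs => rw [hT]
  simp [frob]

/-- Duality: the nuclear norm is attained by a tensor of spectral norm at most one. -/
lemma exists_frob_eq_nuclearNorm (T : Fin n₁ → Fin n₂ → Fin n₃ → ℝ) :
    ∃ Z : Fin n₁ → Fin n₂ → Fin n₃ → ℝ, frob T Z = nuclearNorm T ∧
      ∀ x y z, ‖x‖ = 1 → ‖y‖ = 1 → ‖z‖ = 1 → tmul Z x y z ≤ 1 := by
  rcases eq_or_ne T 0 with rfl | hT
  · exact ⟨0, by simp [frob, nuclearNorm_zero], by simp [tmul]⟩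
  obtain ⟨g, hg, hgN⟩ := exists_extension_of_le_sublinear
    (LinearPMap.mkSpanSingleton (K := ℝ) T (nuclearNorm T) hT) nuclearNorm
    (fun c hc S => nuclearNorm_smul hc S) nuclearNorm_add_le (by
      rintro ⟨S, hS⟩
      obtain ⟨c, rfl⟩ := Submodule.mem_span_singleton.1 hS
      rw [LinearPMap.mkSpanSingleton'_apply]
      rcases le_or_gt c 0 with hc | hc
      · exact (mul_nonpos_of_nonpos_of_nonneg hc (nuclearNorm_nonneg T)).trans
          (nuclearNorm_nonneg _)
      · exact (nuclearNorm_smul hc T).ge)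
  obtain ⟨Z, hZ⟩ := exists_frob_eq g
  refine ⟨Z, ?_, fun x y z hx hy hz => ?_⟩
  · rw [← hZ, hg ⟨T, Submodule.mem_span_singleton_self T⟩]
    exact LinearPMap.mkSpanSingleton_apply ℝ ℝ hT _
  · rw [← frob_rankOneTensor, ← hZ]
    exact (hgN _).trans (nuclearNorm_rankOneTensor_le hx hy hz)

/-- A trilinear form bounded by `1` on a `τ`-hitting set is bounded by `1 / τ` on the sphere. -/
lemma mul_abs_tmul_le_one {τ : ℝ} (hτ : 0 < τ) {H : Set (EuclideanSpace ℝ (Fin n₁))}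
    (hH : IsHittingSet H τ) {Z : Fin n₁ → Fin n₂ → Fin n₃ → ℝ}
    {x : EuclideanSpace ℝ (Fin n₁)} {y : EuclideanSpace ℝ (Fin n₂)}
    {z : EuclideanSpace ℝ (Fin n₃)} (hZ : ∀ v ∈ H, tmul Z v y z ≤ 1) (hx : ‖x‖ = 1) :
    τ * |tmul Z x y z| ≤ 1 := by
  let g : EuclideanSpace ℝ (Fin n₁) := WithLp.toLp 2 fun i => ∑ j, ∑ k, Z i j k * y j * z k
  have hg (v : EuclideanSpace ℝ (Fin n₁)) : tmul Z v y z = ⟪g, v⟫ := by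
    simp only [tmul, g, PiLp.inner_apply, RCLike.inner_apply, conj_trivial, Finset.mul_sum]
    refine Finset.sum_congr rfl fun i _ => Finset.sum_congr rfl fun j _ =>
      Finset.sum_congr rfl fun k _ => by ring
  have hle : |tmul Z x y z| ≤ ‖g‖ := by
    simpa [hg, hx] using abs_real_inner_le_norm g x
  rcases eq_or_ne g 0 with h0 | h0
  · have : |tmul Z x y z| = 0 := le_antisymm (by simpa [h0] using hle) (abs_nonneg _)
    simp [this]
  have hpos : 0 < ‖g‖ := norm_pos_iff.2 h0
  obtain ⟨v, hv, hτv⟩ := hH.2 (‖g‖⁻¹ • g) (by simp [norm_smul, hpos.ne'])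
  rw [real_inner_smul_left, le_inv_mul_iff₀ hpos, ← hg] at hτv
  nlinarith [hZ v hv]

/-- The Frobenius product with a decomposed tensor is a weighted sum of trilinear values. -/
lemma frob_eq_sum_tmul {ι : Type*} [Fintype ι] {T : Fin n₁ → Fin n₂ → Fin n₃ → ℝ}
    {lam : ι → ℝ} {x : ι → EuclideanSpace ℝ (Fin n₁)} {y : ι → EuclideanSpace ℝ (Fin n₂)}
    {z : ι → EuclideanSpace ℝ (Fin n₃)}
    (hT : ∀ i j k, T i j k = ∑ l, lam l * x l i * y l j * z l k)
    (Z : Fin n₁ → Fin n₂ → Fin n₃ → ℝ) :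
    frob T Z = ∑ l, lam l * tmul Z (x l) (y l) (z l) := by
  simp only [frob, tmul, hT, Finset.sum_mul, Finset.mul_sum]
  rw [Finset.sum_comm (s := (Finset.univ : Finset ι))]
  refine Finset.sum_congr rfl fun i _ => ?_
  rw [Finset.sum_comm (s := (Finset.univ : Finset ι))]
  refine Finset.sum_congr rfl fun j _ => ?_
  rw [Finset.sum_comm (s := (Finset.univ : Finset ι))]
  exact Finset.sum_congr rfl fun k _ => Finset.sum_congr rfl fun l _ => by ring

lemma mul_frob_le_nuclearNorm {τ : ℝ} (hτ : 0 < τ) {H : Set (EuclideanSpace ℝ (Fin n₁))}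
    (hH : IsHittingSet H τ) (T : Fin n₁ → Fin n₂ → Fin n₃ → ℝ)
    {Z : Fin n₁ → Fin n₂ → Fin n₃ → ℝ}
    (hZ : ∀ x ∈ H, ∀ y : EuclideanSpace ℝ (Fin n₂), ‖y‖ = 1 →
      ∀ w : EuclideanSpace ℝ (Fin n₃), ‖w‖ = 1 → tmul Z x y w ≤ 1) :
    τ * frob T Z ≤ nuclearNorm T := by
  refine le_nuclearNorm fun s hs => ?_
  obtain ⟨r, lam, x, y, z, hu, hT, rfl⟩ := hs
  rw [frob_eq_sum_tmul hT, Finset.mul_sum]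
  refine Finset.sum_le_sum fun l _ => ?_
  have h := mul_abs_tmul_le_one hτ hH
    (fun v hv => hZ v hv (y l) (hu l).2.1 (z l) (hu l).2.2) (hu l).1
  calc τ * (lam l * tmul Z (x l) (y l) (z l))
      ≤ τ * |lam l * tmul Z (x l) (y l) (z l)| := by gcongr; exact le_abs_self _
    _ = |lam l| * (τ * |tmul Z (x l) (y l) (z l)|) := by rw [abs_mul]; ring
    _ ≤ |lam l| := mul_le_of_le_one_right (abs_nonneg _) h

end NuclearNorm

/-- Let `H ⊆ S^{n₁}` be a finite `τ`-hitting set (`τ ∈ (0,1]`) and let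
`u = sup{⟨T,Z⟩ : Z(x,y,w) ≤ 1 for all x ∈ H and unit y, w}`. Then
`‖T‖_* ≤ u ≤ ‖T‖_*/τ`, equivalently `τ·u ≤ ‖T‖_* ≤ u`. -/
theorem stmt17 (n₁ n₂ n₃ : ℕ) (h₁ : 1 ≤ n₁) (h₂ : 1 ≤ n₂) (h₃ : 1 ≤ n₃)
    (T : Fin n₁ → Fin n₂ → Fin n₃ → ℝ) (τ : ℝ) (hτ0 : 0 < τ) (hτ1 : τ ≤ 1)
    (H : Set (EuclideanSpace ℝ (Fin n₁))) (hH : IsHittingSet H τ) (hfin : H.Finite) :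
    nuclearNorm T ≤
      sSup {v : ℝ | ∃ Z : Fin n₁ → Fin n₂ → Fin n₃ → ℝ,
        (∀ x ∈ H, ∀ y : EuclideanSpace ℝ (Fin n₂), ‖y‖ = 1 →
          ∀ w : EuclideanSpace ℝ (Fin n₃), ‖w‖ = 1 → tmul Z x y w ≤ 1) ∧ v = frob T Z} ∧
    τ * sSup {v : ℝ | ∃ Z : Fin n₁ → Fin n₂ → Fin n₃ → ℝ,
        (∀ x ∈ H, ∀ y : EuclideanSpace ℝ (Fin n₂), ‖y‖ = 1 →
          ∀ w : EuclideanSpace ℝ (Fin n₃), ‖w‖ = 1 → tmul Z x y w ≤ 1) ∧ v = frob T Z} ≤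
      nuclearNorm T := by
  have hbound : ∀ v ∈ {v : ℝ | ∃ Z : Fin n₁ → Fin n₂ → Fin n₃ → ℝ,
      (∀ x ∈ H, ∀ y : EuclideanSpace ℝ (Fin n₂), ‖y‖ = 1 →
        ∀ w : EuclideanSpace ℝ (Fin n₃), ‖w‖ = 1 → tmul Z x y w ≤ 1) ∧ v = frob T Z},
      v ≤ nuclearNorm T / τ := by
    rintro v ⟨Z, hZ, rfl⟩
    rw [le_div_iff₀' hτ0]
    exact mul_frob_le_nuclearNorm hτ0 hH T hZ
  obtain ⟨Z, hTZ, hZ⟩ := exists_frob_eq_nuclearNorm T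
  have hmem : nuclearNorm T ∈ {v : ℝ | ∃ Z : Fin n₁ → Fin n₂ → Fin n₃ → ℝ,
      (∀ x ∈ H, ∀ y : EuclideanSpace ℝ (Fin n₂), ‖y‖ = 1 →
        ∀ w : EuclideanSpace ℝ (Fin n₃), ‖w‖ = 1 → tmul Z x y w ≤ 1) ∧ v = frob T Z} :=
    ⟨Z, fun x hx y hy w hw => hZ x y w (hH.1 x hx) hy hw, hTZ.symm⟩
  refine ⟨le_csSup ⟨_, hbound⟩ hmem, ?_⟩
  rw [← le_div_iff₀' hτ0]
  exact csSup_le ⟨_, hmem⟩ hbound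
end
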